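/- arXiv:1406.6531 — 11 statements merged into one kernel-verified Lean document; each statement's English description precedes it below -/
import Mathlib

section
/- Szemerédi Regularity Lemma: For every ε > 0 and every positive integer k₀ there exists an integer N = N(ε, k₀) such that every finite simple graph G on n ≥ N vertices admits a partition of its vertex set into sets V₀, V₁, …, V_k such that (i) k₀ ≤ k ≤ N and |V₀| ≤ εn, (ii) |V₁| = |V₂| = ⋯ = |V_k|, and (iii) for all but at most εk² of the pairs 1 ≤ i < j ≤ k, the pair (V_i, V_j) is ε-regular in G. -/
open Finset
open scoped Classical

/-- The number of edges of `G` between `A` and `B` (for disjoint `A`, `B`). -/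
noncomputable def edgeCnt {V : Type*} (G : SimpleGraph V) (A B : Finset V) : ℕ :=
  ((A ×ˢ B).filter fun p => G.Adj p.1 p.2).card

/-- The density of the pair `(A, B)` in `G`. -/
noncomputable def pairDensity {V : Type*} (G : SimpleGraph V) (A B : Finset V) : ℝ :=
  (edgeCnt G A B : ℝ) / ((A.card : ℝ) * (B.card : ℝ))

/-- The pair `(A, B)` is `ε`-regular in `G`: for all `X ⊆ A`, `Y ⊆ B` with
`|X| ≥ ε|A|` and `|Y| ≥ ε|B|` we have `|d(A,B) − d(X,Y)| < ε`. -/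
def IsRegularPair {V : Type*} (G : SimpleGraph V) (ε : ℝ) (A B : Finset V) : Prop :=
  ∀ X ⊆ A, ∀ Y ⊆ B, ε * (A.card : ℝ) ≤ (X.card : ℝ) → ε * (B.card : ℝ) ≤ (Y.card : ℝ) →
    |pairDensity G A B - pairDensity G X Y| < ε

theorem pairDensity_eq_edgeDensity {V : Type*} (G : SimpleGraph V) (A B : Finset V) :
    pairDensity G A B = (G.edgeDensity A B : ℝ) := by
  rw [← SimpleGraph.card_interedges_div_card]
  push_cast
  rfl

/-- Uniformity of a pair is inherited, with a worse parameter, by subsets containing at least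
half of each side. -/
theorem SimpleGraph.IsUniform.isRegularPair {V : Type*} {G : SimpleGraph V} {ε δ : ℝ}
    {A B A' B' : Finset V} (h : G.IsUniform δ A B) (hδε : 2 * δ ≤ ε) (hδ : δ ≤ 1 / 2)
    (hA : A' ⊆ A) (hB : B' ⊆ B) (hA' : #A ≤ 2 * #A') (hB' : #B ≤ 2 * #B') :
    IsRegularPair G ε A' B' := by
  intro X hX Y hY hXc hYc
  have hδ0 := h.pos
  have hAr : (#A : ℝ) ≤ 2 * #A' := mod_cast hA'
  have hBr : (#B : ℝ) ≤ 2 * #B' := mod_cast hB'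
  have hA0 : (0 : ℝ) ≤ #A' := Nat.cast_nonneg _
  have hB0 : (0 : ℝ) ≤ #B' := Nat.cast_nonneg _
  have h₁ := h hA hB (by nlinarith) (by nlinarith)
  have h₂ := h (hX.trans hA) (hY.trans hB) (by nlinarith) (by nlinarith)
  rw [pairDensity_eq_edgeDensity, pairDensity_eq_edgeDensity]
  rw [abs_lt] at *
  constructor <;> linarith

/-- **Szemerédi's Regularity Lemma.** -/
theorem szemeredi_regularity_lemma (ε : ℝ) (hε : 0 < ε) (k₀ : ℕ) (hk₀ : 0 < k₀) :
    ∃ N : ℕ, ∀ (V : Type) [Fintype V] (G : SimpleGraph V),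
      N ≤ Fintype.card V →
      ∃ (k : ℕ) (V₀ : Finset V) (P : Fin k → Finset V),
        -- the sets form a partition of the vertex set
        (∀ i, Disjoint V₀ (P i)) ∧
        (∀ i j, i ≠ j → Disjoint (P i) (P j)) ∧
        (∀ v : V, v ∈ V₀ ∨ ∃ i, v ∈ P i) ∧
        -- (i)
        k₀ ≤ k ∧ k ≤ N ∧ (V₀.card : ℝ) ≤ ε * (Fintype.card V : ℝ) ∧
        -- (ii)
        (∀ i j, (P i).card = (P j).card) ∧
        -- (iii)
        ((Set.ncard {p : Fin k × Fin k |
            p.1 < p.2 ∧ ¬ IsRegularPair G ε (P p.1) (P p.2)} : ℝ)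
          ≤ ε * (k : ℝ) ^ 2) := by
  set δ : ℝ := min ε 1 / 2 with hδ_def
  have hδ0 : 0 < δ := by positivity
  have hδε : 2 * δ ≤ ε := by linarith [min_le_left ε 1]
  have hδ : δ ≤ 1 / 2 := by linarith [min_le_right ε 1]
  set M := SzemerediRegularity.bound δ k₀
  refine ⟨k₀ + M + ⌈(M : ℝ) / ε⌉₊, fun V _ G hN ↦ ?_⟩
  obtain ⟨Q, hQ, hkQ, hQM, hunif⟩ := szemeredi_regularity G hδ0 (by omega : k₀ ≤ Fintype.card V)
  set k := #Q.parts
  set m := Fintype.card V / k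
  have hk : 0 < k := hk₀.trans_le hkQ
  have hm : 1 ≤ m := (Nat.one_le_div_iff hk).2 (by omega)
  let e : Fin k ≃ Q.parts := Q.parts.equivFin.symm
  have hle (i : Fin k) : m ≤ #(e i : Finset V) := hQ.average_le_card_part (e i).2
  have hge (i : Fin k) : #(e i : Finset V) ≤ m + 1 := hQ.card_part_le_average_add_one (e i).2
  choose P hPsub hPcard using fun i ↦ exists_subset_card_eq (hle i)
  have hne {i j : Fin k} (hij : i ≠ j) : (e i : Finset V) ≠ e j := fun h ↦
    hij (e.injective (Subtype.ext h))
  have hdisj (i j : Fin k) (hij : i ≠ j) : Disjoint (P i) (P j) :=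
    (Q.disjoint (e i).2 (e j).2 (hne hij)).mono (hPsub i) (hPsub j)
  have hV₀ : #(univ.biUnion P)ᶜ ≤ M := by
    rw [card_compl, card_biUnion fun i _ j _ ↦ hdisj i j]
    simp only [hPcard, sum_const, card_univ, Fintype.card_fin, smul_eq_mul]
    have : k * m + Fintype.card V % k = Fintype.card V := Nat.div_add_mod _ _
    have := Nat.mod_lt (Fintype.card V) hk
    omega
  refine ⟨k, (univ.biUnion P)ᶜ, P, fun i ↦ ?_, hdisj, fun v ↦ ?_, hkQ, by omega, ?_,
    fun i j ↦ by rw [hPcard, hPcard], ?_⟩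
  · exact disjoint_compl_left.mono_right (subset_biUnion_of_mem P (mem_univ i))
  · simpa [or_comm] using em (∃ i, v ∈ P i)
  · have h₁ : (M : ℝ) / ε ≤ Fintype.card V :=
      (Nat.le_ceil _).trans (mod_cast (by omega : ⌈(M : ℝ) / ε⌉₊ ≤ Fintype.card V))
    rw [div_le_iff₀' hε] at h₁
    exact le_trans (mod_cast hV₀) h₁
  · have hcard : Set.ncard {p : Fin k × Fin k |
        p.1 < p.2 ∧ ¬ IsRegularPair G ε (P p.1) (P p.2)} ≤ #(Q.nonUniforms G δ) := by
      rw [← Set.ncard_coe_finset]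
      refine Set.ncard_le_ncard_of_injOn
        (fun p ↦ ((e p.1 : Finset V), (e p.2 : Finset V))) ?_ ?_ (finite_toSet _)
      · rintro ⟨i, j⟩ ⟨hij, hreg⟩
        refine mem_coe.2 ((Q.mk_mem_nonUniforms G).2
          ⟨(e i).2, (e j).2, hne hij.ne, fun hU ↦ hreg ?_⟩)
        have hhalf (l : Fin k) : #(e l : Finset V) ≤ 2 * #(P l) := by
          have := hge l
          have := hPcard l
          omega
        exact hU.isRegularPair hδε hδ (hPsub i) (hPsub j) (hhalf i) (hhalf j)
      · rintro ⟨i, j⟩ - ⟨i', j'⟩ - h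
        simpa [Subtype.ext_iff] using h
    calc _ ≤ (#(Q.nonUniforms G δ) : ℝ) := mod_cast hcard
      _ ≤ (k * (k - 1) : ℕ) * δ := hunif
      _ ≤ (k ^ 2 : ℕ) * ε := by
        gcongr
        · rw [sq]
          exact Nat.mul_le_mul_left k (Nat.sub_le k 1)
        · linarith
      _ = ε * (k : ℝ) ^ 2 := by push_cast; ring
end

section
/- Let 0 < d ≤ 1 and 0 < 3ε ≤ d². Suppose G is a bipartite graph with vertex classes A and B, |A| = |B| = n, such that (A,B) is ε-regular in G with density d, and every vertex of G has degree at least (d − ε)n. Then G contains a perfect matching, i.e. there is a bijection f : A → B such that a is adjacent to f(a) in G for every a ∈ A. -/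
open Finset
open scoped Classical

theorem pairDensity_eq_zero {V : Type*} (G : SimpleGraph V) {X Y : Finset V}
    (h : ∀ x ∈ X, ∀ y ∈ Y, ¬ G.Adj x y) : pairDensity G X Y = 0 := by
  have h0 : edgeCnt G X Y = 0 := by
    rw [edgeCnt, card_eq_zero, filter_eq_empty_iff]
    rintro ⟨x, y⟩ hp
    rw [mem_product] at hp
    exact h x hp.1 y hp.2
  simp [pairDensity, h0]

/-- Hall's condition for a regular pair with large minimum degree. -/
theorem IsRegularPair.card_le_card_biUnion_neighborFinset {V : Type*} [Fintype V]
    {G : SimpleGraph V} {ε d : ℝ} {n : ℕ} {A B : Finset V} (hε : 0 < ε) (hεd : 2 * ε ≤ d)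
    (hAN : ∀ a ∈ A, G.neighborFinset a ⊆ B) (hBN : ∀ b ∈ B, G.neighborFinset b ⊆ A)
    (hA : A.card = n) (hB : B.card = n)
    (hreg : IsRegularPair G ε A B) (hdens : pairDensity G A B = d)
    (hdeg : ∀ v : V, (d - ε) * (n : ℝ) ≤ (G.degree v : ℝ)) {S : Finset V} (hS : S ⊆ A) :
    S.card ≤ (S.biUnion fun a => G.neighborFinset a).card := by
  set T := S.biUnion fun a => G.neighborFinset a with hT
  by_contra! hlt
  have hTB : T ⊆ B := biUnion_subset.2 fun a ha => hAN a (hS ha)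
  have hSn : S.card ≤ n := hA ▸ card_le_card hS
  have hεn : ε * n ≤ (d - ε) * n := by gcongr; linarith
  have hnonadj : ∀ x ∈ S, ∀ y ∈ B \ T, ¬ G.Adj x y := fun x hx y hy hxy =>
    (mem_sdiff.1 hy).2 (mem_biUnion.2 ⟨x, hx, (G.mem_neighborFinset x y).2 hxy⟩)
  have hS_large : ε * A.card ≤ S.card := by
    obtain ⟨a, ha⟩ := card_pos.1 (Nat.zero_lt_of_lt hlt)
    have h1 : G.degree a ≤ S.card :=
      (card_le_card (subset_biUnion_of_mem (fun a => G.neighborFinset a) ha)).trans hlt.le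
    have h2 : (G.degree a : ℝ) ≤ S.card := by exact_mod_cast h1
    rw [hA]
    linarith [hdeg a]
  have hBT : (B \ T).card = n - T.card := by rw [card_sdiff_of_subset hTB, hB]
  have hBT_large : ε * B.card ≤ (B \ T).card := by
    obtain ⟨b, hb⟩ := card_pos.1 (show 0 < (B \ T).card by omega)
    have hsub : G.neighborFinset b ⊆ A \ S := fun x hx =>
      mem_sdiff.2 ⟨hBN b (mem_sdiff.1 hb).1 hx, fun hxS =>
        hnonadj x hxS b hb ((G.mem_neighborFinset b x).1 hx).symm⟩
    have h1 : G.degree b ≤ (B \ T).card := by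
      have := card_le_card hsub
      rw [card_sdiff_of_subset hS, hA, G.card_neighborFinset_eq_degree] at this
      omega
    have h2 : (G.degree b : ℝ) ≤ (B \ T).card := by exact_mod_cast h1
    rw [hB]
    linarith [hdeg b]
  have key := hreg S hS (B \ T) sdiff_subset hS_large hBT_large
  rw [hdens, pairDensity_eq_zero G hnonadj, sub_zero] at key
  linarith [le_abs_self d]

/-- An `ε`-regular bipartite graph of density `d` with minimum degree at least
`(d − ε)n` contains a perfect matching. -/
theorem regular_bipartite_perfect_matching {V : Type} [Fintype V]
    (G : SimpleGraph V) (ε d : ℝ) (n : ℕ)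
    (hd0 : 0 < d) (hd1 : d ≤ 1) (hε : 0 < ε) (hεd : 3 * ε ≤ d ^ 2)
    (A B : Finset V) (hAB : Disjoint A B) (hcover : ∀ v : V, v ∈ A ∨ v ∈ B)
    (hbip : ∀ x y : V, G.Adj x y → (x ∈ A ∧ y ∈ B) ∨ (x ∈ B ∧ y ∈ A))
    (hA : A.card = n) (hB : B.card = n)
    (hreg : IsRegularPair G ε A B) (hdens : pairDensity G A B = d)
    (hdeg : ∀ v : V, (d - ε) * (n : ℝ) ≤ (G.degree v : ℝ)) :
    ∃ f : A → B, Function.Bijective f ∧ ∀ a : A, G.Adj a.1 (f a).1 := by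
  have hAN : ∀ a ∈ A, G.neighborFinset a ⊆ B := fun a ha x hx =>
    (hbip a x ((G.mem_neighborFinset a x).1 hx)).elim And.right
      fun h => absurd h.1 (disjoint_left.1 hAB ha)
  have hBN : ∀ b ∈ B, G.neighborFinset b ⊆ A := fun b hb x hx =>
    (hbip b x ((G.mem_neighborFinset b x).1 hx)).elim
      (fun h => absurd hb (disjoint_left.1 hAB h.1)) And.right
  have hεd2 : 2 * ε ≤ d := by nlinarith
  obtain ⟨f, hf, hfN⟩ := (all_card_le_biUnion_card_iff_exists_injective
    fun a : A => G.neighborFinset a.1).1 fun S => by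
      have h := hreg.card_le_card_biUnion_neighborFinset hε hεd2 hAN hBN hA hB hdens hdeg
        (S := S.map (Function.Embedding.subtype _)) (map_subtype_subset S)
      rwa [card_map, map_eq_image, image_biUnion] at h
  refine ⟨fun a => ⟨f a, hAN a.1 a.2 (hfN a)⟩, ?_,
    fun a => (G.mem_neighborFinset _ _).1 (hfN a)⟩
  rw [Fintype.bijective_iff_injective_and_card]
  exact ⟨fun a b hab => hf (congrArg Subtype.val hab), by simp [hA, hB]⟩
end

section
/- Erdős–Stone Theorem: Let r ≥ 2 and s ≥ 1 be integers and γ > 0. Then there exists an integer n₀ such that every graph on n ≥ n₀ vertices with at least t_{r−1}(n) + γn² edges contains K^s_r as a subgraph. -/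
open Finset
open scoped Classical

/-- `H` is a subgraph of `G`: there is an injective map from the vertices of `H`
to the vertices of `G` sending edges of `H` to edges of `G`. -/
def ContainsCopy {α β : Type*} (G : SimpleGraph α) (H : SimpleGraph β) : Prop :=
  ∃ f : β → α, Function.Injective f ∧ ∀ a b : β, H.Adj a b → G.Adj (f a) (f b)

/-- `t r n` is the number of edges of the Turán graph `T_r(n)`, the complete
`r`-partite graph on `n` vertices with classes as equal as possible. -/
noncomputable def turanEdges (r n : ℕ) : ℕ :=
  (SimpleGraph.turanGraph n r).edgeFinset.card

open SimpleGraph in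
/-- A graph with many edges contains a graph with many edges all of whose degrees are
proportionally large, obtained by repeatedly deleting a vertex of small degree. -/
theorem exists_isContained_mul_le_minDegree {c K : ℝ} (hc : 0 ≤ c) (n : ℕ) {V : Type*} [Fintype V]
    (G : SimpleGraph V) (hV : Fintype.card V = n)
    (hG : c * (n * (n + 1) / 2) + K ≤ #G.edgeFinset) :
    ∃ (m : ℕ) (G' : SimpleGraph (Fin m)),
      K ≤ #G'.edgeFinset ∧ c * m ≤ G'.minDegree ∧ G' ⊑ G := by
  induction n generalizing V with
  | zero =>
    have e := G.overFinIso hV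
    refine ⟨0, G.overFin hV, ?_, by simp, e.symm.isContained⟩
    rw [← e.card_edgeFinset_eq]
    simpa using hG
  | succ n ih =>
    by_cases hdeg : c * (n + 1 : ℕ) ≤ G.minDegree
    · have e := G.overFinIso hV
      refine ⟨n + 1, G.overFin hV, ?_, ?_, e.symm.isContained⟩
      · rw [← e.card_edgeFinset_eq]
        exact (le_add_of_nonneg_left (by positivity)).trans hG
      · rwa [← e.minDegree_eq]
    · push Not at hdeg
      have : Nonempty V := Fintype.card_pos_iff.mp (by omega)
      obtain ⟨v, hv⟩ := G.exists_minimal_degree_vertex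
      have hcard : Fintype.card ({v}ᶜ : Set V) = n := by
        rw [Fintype.card_compl_set, hV]
        simp
      have hedge : #G.edgeFinset ≤ #(G.induce {v}ᶜ).edgeFinset + G.degree v := by
        rw [G.card_edgeFinset_induce_compl_singleton v, G.card_edgeFinset_deleteIncidenceSet v]
        exact le_tsub_add
      obtain ⟨m, G', hK, hmin, hsub⟩ := ih (G.induce {v}ᶜ) hcard <| by
        have : (#G.edgeFinset : ℝ) ≤ #(G.induce {v}ᶜ).edgeFinset + G.degree v := mod_cast hedge
        rw [hv] at hdeg
        push_cast at hG hdeg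
        rw [← sub_le_iff_le_add] at this
        refine le_trans ?_ (this.trans_eq (by congr!))
        linarith
      exact ⟨m, G', hK, hmin, hsub.trans ⟨Copy.induce G {v}ᶜ⟩⟩

theorem le_turanEdges {q : ℕ} (hq : 0 < q) (n : ℕ) :
    (1 - 1 / q : ℝ) * (n ^ 2 / 2) - (q ^ 2 + 1) ≤ turanEdges q n := by
  have hmod : n % q < q := Nat.mod_lt n hq
  have hqR : (1 : ℝ) ≤ q := mod_cast hq
  have hmodR : ((n % q : ℕ) : ℝ) ^ 2 ≤ (q : ℝ) ^ 2 := by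
    gcongr
  set A := (n ^ 2 - (n % q) ^ 2) * (q - 1) with hA
  have hA_cast : (A : ℝ) = (n ^ 2 - ((n % q : ℕ) : ℝ) ^ 2) * (q - 1) := by
    rw [hA, Nat.cast_mul, Nat.cast_sub (Nat.pow_le_pow_left (Nat.mod_le n q) 2),
      Nat.cast_sub hq]
    push_cast
    ring
  have hturan : A / (2 * q) ≤ turanEdges q n := by
    unfold turanEdges
    have := SimpleGraph.card_edgeFinset_turanGraph (n := n) (r := q)
    convert Nat.le.intro this.symm
  have hdiv : A ≤ (turanEdges q n + 1) * (2 * q) :=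
    (Nat.lt_mul_of_div_lt (Nat.lt_succ_of_le hturan) (by positivity)).le
  have hdivR : (A : ℝ) ≤ (turanEdges q n + 1) * (2 * q) := mod_cast hdiv
  rw [← mul_le_mul_iff_left₀ (show (0 : ℝ) < 2 * q by positivity)]
  have : ((1 - 1 / q : ℝ) * (n ^ 2 / 2) - (q ^ 2 + 1)) * (2 * q)
      = n ^ 2 * (q - 1) - (q ^ 2 + 1) * (2 * q) := by
    field_simp
  rw [this]
  have h₁ : ((n % q : ℕ) : ℝ) ^ 2 * (q - 1) ≤ q ^ 2 * (q - 1) :=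
    mul_le_mul_of_nonneg_right hmodR (by linarith)
  have h₂ : 0 ≤ (q : ℝ) ^ 2 * (q + 1) := by positivity
  nlinarith

/-- **The Erdős–Stone Theorem.** Every graph on `n ≥ n₀` vertices with at least
`t_{r−1}(n) + γn²` edges contains `K^s_r`, the complete `r`-partite graph with
all classes of size `s`. -/
theorem erdos_stone (r s : ℕ) (hr : 2 ≤ r) (hs : 1 ≤ s) (γ : ℝ) (hγ : 0 < γ) :
    ∃ n₀ : ℕ, ∀ (V : Type) [Fintype V] (G : SimpleGraph V),
      n₀ ≤ Fintype.card V →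
      (turanEdges (r - 1) (Fintype.card V) : ℝ) + γ * (Fintype.card V : ℝ) ^ 2 ≤
        (G.edgeFinset.card : ℝ) →
      ContainsCopy G (SimpleGraph.completeMultipartiteGraph fun _ : Fin r => Fin s) := by
  obtain ⟨q, rfl⟩ : ∃ q, r = q + 1 := ⟨r - 1, by omega⟩
  have hq : 0 < q := by omega
  obtain ⟨N, hN⟩ := Filter.eventually_atTop.mp
    (SimpleGraph.eventually_completeEquipartiteGraph_isContained_of_minDegree hγ q s)
  refine ⟨⌈(1 + γ + 2 * (N ^ 2 + q ^ 2 + 1)) / γ⌉₊ + 1, fun V _ G hn hG => ?_⟩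
  set n := Fintype.card V
  have hqR : (1 : ℝ) / q ≤ 1 := by
    rw [div_le_one (by positivity)]
    exact mod_cast hq
  have hq0 : (0 : ℝ) ≤ 1 / q := by positivity
  have hn1 : (1 : ℝ) ≤ n := mod_cast (Nat.le_add_left 1 _).trans hn
  have hnγ : 1 + γ + 2 * (N ^ 2 + q ^ 2 + 1) ≤ γ * n := by
    rw [← div_le_iff₀' hγ]
    exact (Nat.le_ceil _).trans (Nat.cast_le.mpr ((Nat.le_add_right _ 1).trans hn))
  have hedges : (1 - 1 / q + γ) * (n * (n + 1) / 2) + (N : ℝ) ^ 2 ≤ #G.edgeFinset := by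
    refine le_trans ?_ hG
    have hturan := le_turanEdges hq n
    have h₁ := mul_le_mul_of_nonneg_right hnγ (zero_le_one.trans hn1)
    have h₂ : (N ^ 2 + q ^ 2 + 1 : ℝ) * 1 ≤ (N ^ 2 + q ^ 2 + 1) * n := by gcongr
    have h₃ : 0 ≤ (1 / q : ℝ) * n := by positivity
    rw [Nat.add_sub_cancel]
    linarith
  obtain ⟨m, G', hK, hmin, hsub⟩ :=
    exists_isContained_mul_le_minDegree (by linarith) n G rfl hedges
  have hm : N ≤ m := by
    have hchoose : #G'.edgeFinset ≤ m ^ 2 := by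
      refine SimpleGraph.card_edgeFinset_le_card_choose_two.trans ?_
      rw [Fintype.card_fin]
      exact Nat.choose_le_pow m 2
    rw [← Nat.pow_le_pow_iff_left two_ne_zero]
    exact le_trans (mod_cast hK) hchoose
  obtain ⟨f⟩ := (hN m hm hmin).trans hsub
  refine ⟨fun x => f (x.1, x.2), fun x y h => ?_, fun a b hab => ?_⟩
  · obtain ⟨i, j⟩ := x
    obtain ⟨i', j'⟩ := y
    have := f.injective h
    simp_all
  · exact f.toHom.map_adj (SimpleGraph.completeEquipartiteGraph_adj.mpr hab)
end

section
/- Let H be a graph with chromatic number χ(H) ≥ 2. Then the sequence ex(n,H) / (n choose 2) converges, as n → ∞, to (χ(H) − 2)/(χ(H) − 1). -/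
open Finset
open scoped Classical

/-- `exNum n H` is the maximum number of edges of a graph on `n` vertices not
containing `H` as a subgraph. -/
noncomputable def exNum (n : ℕ) {β : Type*} (H : SimpleGraph β) : ℕ :=
  sSup {m : ℕ | ∃ G : SimpleGraph (Fin n), ¬ ContainsCopy G H ∧ G.edgeFinset.card = m}

open SimpleGraph in
theorem containsCopy_iff_isContained {α β : Type*} (G : SimpleGraph α) (H : SimpleGraph β) :
    ContainsCopy G H ↔ H ⊑ G :=
  ⟨fun ⟨f, hf, h⟩ ↦ ⟨⟨⟨f, fun {a b} hab ↦ h a b hab⟩, hf⟩⟩,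
    fun ⟨f⟩ ↦ ⟨f, f.injective, fun _ _ hab ↦ f.toHom.map_adj hab⟩⟩

theorem exNum_eq_extremalNumber (n : ℕ) {β : Type*} (H : SimpleGraph β) :
    exNum n H = SimpleGraph.extremalNumber n H := by
  have hub : ∀ m ∈ {m : ℕ | ∃ G : SimpleGraph (Fin n),
      ¬ ContainsCopy G H ∧ G.edgeFinset.card = m}, m ≤ SimpleGraph.extremalNumber n H := by
    rintro m ⟨G, hG, rfl⟩
    rw [containsCopy_iff_isContained] at hG
    simpa using SimpleGraph.card_edgeFinset_le_extremalNumber hG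
  refine le_antisymm (csSup_le' hub) ?_
  refine Finset.sup_le fun G hG ↦ le_csSup ⟨_, hub⟩ ⟨G, ?_, ?_⟩
  · rw [containsCopy_iff_isContained]
    exact (Finset.mem_filter.1 hG).2
  · convert rfl

namespace SimpleGraph

variable {W : Type*} {H : SimpleGraph W} {r : ℕ}

/-- A graph that is not `r`-colorable has Turán density at least `1 - 1 / r`. -/
theorem one_sub_one_div_le_turanDensity (hr : 1 ≤ r) (hH : ¬ H.Colorable r) :
    1 - 1 / (r : ℝ) ≤ turanDensity H := by
  have hsub : Filter.Tendsto (fun t : ℕ ↦ r * t) Filter.atTop Filter.atTop :=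
    Filter.tendsto_id.const_mul_atTop' (by omega)
  refine ge_of_tendsto ((tendsto_turanDensity H).comp hsub) ?_
  filter_upwards [Filter.eventually_ge_atTop 2] with t ht
  have hfree : H.Free (completeEquipartiteGraph r t) := fun ⟨f⟩ ↦ by
    let C : (completeEquipartiteGraph r t).Coloring (Fin r) := Coloring.mk Prod.fst fun h ↦ h
    exact hH ⟨C.comp f.toHom⟩
  have hle := card_edgeFinset_le_extremalNumber hfree
  have hedge := card_edgeFinset_completeEquipartiteGraph (r := r) (t := t)
  simp only [Fintype.card_prod, Fintype.card_fin] at hle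
  have hle' : ((r.choose 2 * t ^ 2 : ℕ) : ℝ) ≤ extremalNumber (r * t) H := by
    rw [← hedge]
    exact_mod_cast (by convert hle)
  have hr' : (1 : ℝ) ≤ r := by exact_mod_cast hr
  have ht' : (2 : ℝ) ≤ t := by exact_mod_cast ht
  have hrt : (2 : ℝ) ≤ r * t := by nlinarith
  push_cast [Nat.cast_choose_two] at hle'
  simp only [Function.comp_apply]
  rw [Nat.cast_choose_two, le_div_iff₀ (by push_cast; nlinarith)]
  refine le_trans ?_ hle'
  push_cast
  have h : (1 - 1 / (r : ℝ)) * (r * t * (r * t - 1) / 2) = (r - 1) * t * (r * t - 1) / 2 := by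
    field_simp
  rw [h]
  nlinarith [mul_nonneg (sub_nonneg.2 hr') (by positivity : (0 : ℝ) ≤ t)]

/-- If large `H`-free graphs on `n` vertices have minimum degree at most `a * n`, then the extremal
numbers of `H` grow by at most `a * n` in each step. -/
theorem extremalNumber_succ_le {n : ℕ} {a : ℝ} (hH : H ≠ ⊥)
    (h : ∀ G : SimpleGraph (Fin (n + 1)), H.Free G → (G.minDegree : ℝ) ≤ a * (n + 1)) :
    (extremalNumber (n + 1) H : ℝ) ≤ extremalNumber n H + a * (n + 1) := by
  obtain ⟨G, _, hG⟩ := exists_isExtremal_free (V := Fin (n + 1)) hH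
  have hcard := card_edgeFinset_of_isExtremal_free hG
  obtain ⟨v, hv⟩ := G.exists_minimal_degree_vertex
  have hdel := card_edgeFinset_deleteIncidenceSet_le_extremalNumber hG.prop v
  have hsub := G.card_edgeFinset_deleteIncidenceSet v
  simp only [Fintype.card_fin, Nat.add_sub_cancel] at hcard hdel
  have hnat : extremalNumber (n + 1) H ≤ extremalNumber n H + G.degree v := by
    rw [← hcard]
    have : #(G.deleteIncidenceSet v).edgeFinset ≤ extremalNumber n H := by convert hdel
    omega
  have hmin : (G.degree v : ℝ) ≤ a * (n + 1) := by
    rw [← hv]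
    convert h G hG.prop
  have : (extremalNumber (n + 1) H : ℝ) ≤ extremalNumber n H + G.degree v := by
    exact_mod_cast hnat
  linarith

/-- If the extremal numbers of `H` eventually grow by at most `a * n` in each step, then the
Turán density of `H` is at most `a`. -/
theorem turanDensity_le_of_extremalNumber_succ_le {a : ℝ}
    (h : ∀ᶠ n : ℕ in Filter.atTop,
      (extremalNumber (n + 1) H : ℝ) ≤ extremalNumber n H + a * (n + 1)) :
    turanDensity H ≤ a := by
  obtain ⟨N, hN⟩ := Filter.eventually_atTop.1 h
  obtain ⟨C, hC⟩ : ∃ C : ℝ, ∀ n ≥ N,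
      (extremalNumber n H : ℝ) ≤ C + a * ((n : ℝ) * (n + 1) / 2) := by
    refine ⟨extremalNumber N H - a * ((N : ℝ) * (N + 1) / 2), fun n hn ↦ ?_⟩
    induction n, hn using Nat.le_induction with
    | base => linarith
    | succ n hn ih =>
      have := hN n hn
      push_cast
      linarith
  by_contra! hlt
  obtain ⟨m, hm⟩ := exists_nat_gt (1 + 2 * (|C| + |a|) / (turanDensity H - a))
  set n := max m (max N 2)
  have hn2 : (2 : ℝ) ≤ n := by exact_mod_cast (le_max_right N 2).trans (le_max_right _ _)
  have hnm : (m : ℝ) ≤ n := by exact_mod_cast le_max_left _ _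
  have hle : turanDensity H ≤ extremalNumber n H / n.choose 2 :=
    (isGLB_turanDensity H).1 ⟨n, (le_max_right N 2).trans (le_max_right _ _), rfl⟩
  rw [Nat.cast_choose_two, le_div_iff₀ (by nlinarith)] at hle
  have hup := hC n ((le_max_left N 2).trans (le_max_right _ _))
  have hgt : 2 * (|C| + |a|) < (n - 1) * (turanDensity H - a) := by
    rw [← div_lt_iff₀ (sub_pos.2 hlt)]
    linarith
  have hmul := mul_lt_mul_of_pos_left hgt (by linarith : (0 : ℝ) < n)
  nlinarith [le_abs_self C, mul_le_mul_of_nonneg_left (le_abs_self a) (by linarith : (0 : ℝ) ≤ n),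
    mul_le_mul_of_nonneg_right (by linarith : (1 : ℝ) ≤ n) (abs_nonneg C)]

/-- The Turán density of an `(r + 1)`-colorable graph with an edge is at most `1 - 1 / r`. -/
theorem turanDensity_le_one_sub_one_div [Fintype W] (hH : H ≠ ⊥) (hc : H.Colorable (r + 1)) :
    turanDensity H ≤ 1 - 1 / (r : ℝ) := by
  refine le_of_forall_pos_le_add fun ε hε ↦ turanDensity_le_of_extremalNumber_succ_le ?_
  obtain ⟨C⟩ := hc
  have hcont : H ⊑ completeEquipartiteGraph (r + 1) (Fintype.card W) :=
    isContained_completeEquipartiteGraph_of_colorable C _ fun c ↦ Fintype.card_subtype_le _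
  have hev := eventually_completeEquipartiteGraph_isContained_of_minDegree hε r (Fintype.card W)
  filter_upwards [(Filter.tendsto_add_atTop_nat 1).eventually hev] with n hn
  refine extremalNumber_succ_le hH fun G hG ↦ ?_
  by_contra! hlt
  refine hG (hcont.trans (hn ?_))
  push_cast
  exact hlt.le

end SimpleGraph

/-- Corollary of the Erdős–Stone theorem: for a graph `H` of chromatic number
`χ(H) ≥ 2`, `ex(n,H)/(n choose 2)` tends to `(χ(H) − 2)/(χ(H) − 1)`. -/
theorem erdos_stone_simonovits {β : Type} [Fintype β] (H : SimpleGraph β)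
    (χ : ℕ) (hχ : H.chromaticNumber = (χ : ℕ∞)) (hχ2 : 2 ≤ χ) :
    Filter.Tendsto (fun n : ℕ => (exNum n H : ℝ) / (n.choose 2 : ℝ))
      Filter.atTop (nhds (((χ : ℝ) - 2) / ((χ : ℝ) - 1))) := by
  obtain ⟨r, rfl⟩ : ∃ r, χ = r + 1 := ⟨χ - 1, by omega⟩
  have hr : 1 ≤ r := by omega
  have hcol : H.Colorable (r + 1) := SimpleGraph.chromaticNumber_le_iff_colorable.1 hχ.le
  have hncol : ¬ H.Colorable r := fun h ↦ by
    have := SimpleGraph.chromaticNumber_le_iff_colorable.2 h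
    rw [hχ, Nat.cast_le] at this
    omega
  have hbot : H ≠ ⊥ := by
    rintro rfl
    exact hncol ((SimpleGraph.colorable_one_iff.2 rfl).mono hr)
  have hlim : SimpleGraph.turanDensity H = (((r + 1 : ℕ) : ℝ) - 2) / (((r + 1 : ℕ) : ℝ) - 1) := by
    rw [(SimpleGraph.turanDensity_le_one_sub_one_div hbot hcol).antisymm
      (SimpleGraph.one_sub_one_div_le_turanDensity hr hncol)]
    have : (r : ℝ) ≠ 0 := by positivity
    push_cast
    rw [add_sub_cancel_right]
    field_simp
    ring
  simp only [exNum_eq_extremalNumber, ← hlim]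
  exact SimpleGraph.tendsto_turanDensity H
end

section
/- Linear Ramsey numbers for bounded-degree graphs (Chvátal–Rödl–Szemerédi–Trotter): For every positive integer Δ there exists a constant c such that for every graph H with maximum degree Δ(H) ≤ Δ and every graph G on n ≥ c·|H| vertices, either H is a subgraph of G or H is a subgraph of the complement of G. Equivalently, R(H) ≤ c|H| for every graph H with Δ(H) ≤ Δ. -/
open Finset
open scoped Classical

section

variable {α β : Type*}

/-- `f` restricts to a copy of `H[S]` in `G`. -/
def IsPartialCopy (G : SimpleGraph α) (H : SimpleGraph β) (S : Finset β) (f : β → α) : Prop :=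
  Set.InjOn f S ∧ ∀ a ∈ S, ∀ b ∈ S, H.Adj a b → G.Adj (f a) (f b)

theorem IsPartialCopy.update {G : SimpleGraph α} {H : SimpleGraph β} {S : Finset β} {f : β → α}
    (hf : IsPartialCopy G H S f) {a : β} (ha : a ∉ S) {x : α} (hx : x ∉ S.image f)
    (hadj : ∀ b ∈ S, H.Adj a b → G.Adj (f b) x) :
    IsPartialCopy G H (insert a S) (Function.update f a x) := by
  have hne : ∀ b ∈ S, b ≠ a := fun b hb h => ha (h ▸ hb)
  have hx' : ∀ b ∈ S, f b ≠ x := fun b hb h => hx (Finset.mem_image.2 ⟨b, hb, h⟩)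
  constructor
  · intro b hb b' hb' h
    simp only [Finset.coe_insert, Set.mem_insert_iff, Finset.mem_coe] at hb hb'
    rcases hb with rfl | hb <;> rcases hb' with rfl | hb'
    · rfl
    · rw [Function.update_self, Function.update_of_ne (hne _ hb')] at h
      exact absurd h.symm (hx' _ hb')
    · rw [Function.update_self, Function.update_of_ne (hne _ hb)] at h
      exact absurd h (hx' _ hb)
    · rw [Function.update_of_ne (hne _ hb), Function.update_of_ne (hne _ hb')] at h
      exact hf.1 hb hb' h
  · intro b hb b' hb' h
    simp only [Finset.mem_insert] at hb hb'
    rcases hb with rfl | hb <;> rcases hb' with rfl | hb'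
    · exact absurd h H.irrefl
    · rw [Function.update_self, Function.update_of_ne (hne _ hb')]
      exact (hadj _ hb' h).symm
    · rw [Function.update_self, Function.update_of_ne (hne _ hb)]
      exact hadj _ hb h.symm
    · rw [Function.update_of_ne (hne _ hb), Function.update_of_ne (hne _ hb')]
      exact hf.2 _ hb _ hb' h

theorem IsPartialCopy.containsCopy [Fintype β] {G : SimpleGraph α} {H : SimpleGraph β}
    {f : β → α} (hf : IsPartialCopy G H Finset.univ f) : ContainsCopy G H :=
  ⟨f, fun a b h => hf.1 (by simp) (by simp) h, fun a b h => hf.2 a (by simp) b (by simp) h⟩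

theorem card_filter_adj_le_of_maxDegree_le [Fintype β] {H : SimpleGraph β} {Δ : ℕ}
    (hH : H.maxDegree ≤ Δ) (S : Finset β) (v : β) : #{w ∈ S | H.Adj v w} ≤ Δ := by
  refine le_trans (Finset.card_le_card fun w hw => ?_) ((H.degree_le_maxDegree v).trans hH)
  simpa using (Finset.mem_filter.1 hw).2

/-- Greedy colouring with `Δ + 1` colours. -/
theorem exists_coloring_lt_of_maxDegree_le [Fintype β] {H : SimpleGraph β} {Δ : ℕ}
    (hH : H.maxDegree ≤ Δ) :
    ∃ φ : β → ℕ, (∀ a, φ a < Δ + 1) ∧ ∀ a b, H.Adj a b → φ a ≠ φ b := by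
  suffices h : ∀ S : Finset β, ∃ φ : β → ℕ, (∀ a, φ a < Δ + 1) ∧
      ∀ a ∈ S, ∀ b ∈ S, H.Adj a b → φ a ≠ φ b by
    obtain ⟨φ, h₁, h₂⟩ := h Finset.univ
    exact ⟨φ, h₁, fun a b => h₂ a (by simp) b (by simp)⟩
  intro S
  induction S using Finset.induction_on with
  | empty => exact ⟨fun _ => 0, by simp, by simp⟩
  | insert v S hv ih =>
    obtain ⟨φ, h₁, h₂⟩ := ih
    obtain ⟨k, hk, hk'⟩ : ∃ k ∈ Finset.range (Δ + 1), k ∉ {w ∈ S | H.Adj v w}.image φ := by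
      refine Finset.exists_mem_notMem_of_card_lt_card ?_
      rw [Finset.card_range, Nat.lt_succ_iff]
      exact Finset.card_image_le.trans (card_filter_adj_le_of_maxDegree_le hH S v)
    have hne : ∀ b ∈ S, H.Adj v b → φ b ≠ k := fun b hb hvb h =>
      hk' (Finset.mem_image.2 ⟨b, Finset.mem_filter.2 ⟨hb, hvb⟩, h⟩)
    have hSv : ∀ b ∈ S, b ≠ v := fun b hb h => hv (h ▸ hb)
    refine ⟨Function.update φ v k, fun a => ?_, fun a ha b hb hab => ?_⟩
    · by_cases h : a = v
      · subst h; simpa using hk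
      · simpa [Function.update_of_ne h] using h₁ a
    · simp only [Finset.mem_insert] at ha hb
      rcases ha with rfl | ha <;> rcases hb with rfl | hb
      · exact absurd hab H.irrefl
      · rw [Function.update_self, Function.update_of_ne (hSv _ hb)]
        exact (hne _ hb hab).symm
      · rw [Function.update_self, Function.update_of_ne (hSv _ ha)]
        exact hne _ ha hab.symm
      · rw [Function.update_of_ne (hSv _ ha), Function.update_of_ne (hSv _ hb)]
        exact h₂ _ ha _ hb hab

/-- If `H` does not embed in `G[W]`, then `W` contains two large sets with few `G`-edges
between them. -/
theorem containsCopy_or_exists_sparse_pair [Fintype β] [Nonempty β] {H : SimpleGraph β} {Δ : ℕ}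
    (hΔ : 0 < Δ) (hH : H.maxDegree ≤ Δ) (G : SimpleGraph α) {Q R : ℕ} (hQ : 0 < Q)
    (hR : R = 2 * Δ * Q ^ Δ) (W : Finset α) (hW : 2 * Q ^ Δ * Fintype.card β ≤ #W) :
    ContainsCopy G H ∨ ∃ X ⊆ W, ∃ Y ⊆ W, #W ≤ R * #X ∧ #W ≤ R * #Y ∧
      ∀ x ∈ X, Q * #{y ∈ Y | G.Adj x y} < #Y := by
  by_cases hsparse : ∃ X ⊆ W, ∃ Y ⊆ W, #W ≤ R * #X ∧ #W ≤ R * #Y ∧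
      ∀ x ∈ X, Q * #{y ∈ Y | G.Adj x y} < #Y
  · exact Or.inr hsparse
  left
  have hQΔ : 0 < Q ^ Δ := by positivity
  have hβ : 0 < Fintype.card β := Fintype.card_pos
  have hWpos : 0 < #W := lt_of_lt_of_le (by positivity) hW
  have hbad : ∀ Y ⊆ W, #W ≤ Q ^ Δ * #Y →
      R * #{x ∈ W | Q * #{y ∈ Y | G.Adj x y} < #Y} < #W := by
    intro Y hY hYc
    by_contra! hc
    refine hsparse ⟨_, Finset.filter_subset _ _, Y, hY, hc, hYc.trans ?_, fun x hx =>
      (Finset.mem_filter.1 hx).2⟩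
    refine Nat.mul_le_mul_right _ ?_
    rw [hR]
    exact Nat.le_mul_of_pos_left _ (by positivity)
  let C (f : β → α) (S : Finset β) (u : β) : Finset α :=
    {x ∈ W | ∀ w ∈ S, H.Adj u w → G.Adj (f w) x}
  suffices h : ∀ S : Finset β, ∃ f : β → α, IsPartialCopy G H S f ∧
      ∀ u ∉ S, #W ≤ Q ^ #{w ∈ S | H.Adj u w} * #(C f S u) by
    obtain ⟨f, hf, -⟩ := h Finset.univ
    exact hf.containsCopy
  intro S
  induction S using Finset.induction_on with
  | empty =>
    obtain ⟨x, -⟩ := Finset.card_pos.1 hWpos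
    exact ⟨fun _ => x, ⟨by simp, by simp⟩, by simp [C]⟩
  | insert v S hv ih =>
    obtain ⟨f, hf, hC⟩ := ih
    have hC' : ∀ u ∉ S, #W ≤ Q ^ Δ * #(C f S u) := fun u hu => (hC u hu).trans
      (Nat.mul_le_mul_right _
        (Nat.pow_le_pow_right hQ (card_filter_adj_le_of_maxDegree_le hH S u)))
    let U : Finset β := {u | H.Adj v u ∧ u ∉ S}
    let B (u : β) : Finset α := {x ∈ W | Q * #{y ∈ C f S u | G.Adj x y} < #(C f S u)}
    have hU : #U ≤ Δ := by
      refine (Finset.card_le_card fun u hu => ?_).trans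
        (card_filter_adj_le_of_maxDegree_le hH Finset.univ v)
      simp only [U, Finset.mem_filter] at hu ⊢
      exact ⟨hu.1, hu.2.1⟩
    have hB : 2 * Q ^ Δ * #(U.biUnion B) ≤ #W := by
      refine Nat.le_of_mul_le_mul_left ?_ hΔ
      calc Δ * (2 * Q ^ Δ * #(U.biUnion B)) = R * #(U.biUnion B) := by rw [hR]; ring
        _ ≤ R * ∑ u ∈ U, #(B u) := Nat.mul_le_mul_left _ Finset.card_biUnion_le
        _ = ∑ u ∈ U, R * #(B u) := Finset.mul_sum _ _ _
        _ ≤ ∑ _u ∈ U, #W := Finset.sum_le_sum fun u hu =>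
            (hbad _ (Finset.filter_subset _ _) (hC' u (Finset.mem_filter.1 hu).2.2)).le
        _ = #U * #W := by simp
        _ ≤ Δ * #W := Nat.mul_le_mul_right _ hU
    have hS : #(S.image f) < Fintype.card β :=
      Finset.card_image_le.trans_lt (Finset.card_lt_univ_of_notMem hv)
    obtain ⟨x, hxC, hx⟩ : ∃ x ∈ C f S v, x ∉ U.biUnion B ∪ S.image f := by
      refine Finset.exists_mem_notMem_of_card_lt_card
        ((Finset.card_union_le _ _).trans_lt ?_)
      have h₁ := hC' v hv
      have h₂ := Nat.mul_lt_mul_of_pos_left hS (show 0 < 2 * Q ^ Δ by positivity)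
      refine Nat.lt_of_mul_lt_mul_left (a := 2 * Q ^ Δ) ?_
      nlinarith
    rw [Finset.mem_union, not_or] at hx
    have hxW := Finset.mem_filter.1 hxC
    refine ⟨Function.update f v x, hf.update hv hx.2 hxW.2, fun u hu => ?_⟩
    rw [Finset.mem_insert, not_or] at hu
    have hSv : ∀ b ∈ S, b ≠ v := fun b hb h => hv (h ▸ hb)
    have hCu : C (Function.update f v x) (insert v S) u =
        {y ∈ C f S u | H.Adj u v → G.Adj x y} := by
      ext y
      simp only [C, Finset.mem_filter, Finset.forall_mem_insert, Function.update_self]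
      have : (∀ w ∈ S, H.Adj u w → G.Adj (Function.update f v x w) y) ↔
          ∀ w ∈ S, H.Adj u w → G.Adj (f w) y :=
        forall₂_congr fun w hw => by rw [Function.update_of_ne (hSv w hw)]
      rw [this]
      tauto
    rw [hCu, Finset.filter_insert]
    by_cases huv : H.Adj u v
    · have hxB : x ∉ B u := fun h => hx.1 (Finset.mem_biUnion.2
        ⟨u, by simpa [U] using ⟨huv.symm, hu.2⟩, h⟩)
      have hxB' : #(C f S u) ≤ Q * #{y ∈ C f S u | G.Adj x y} := by
        by_contra! hc
        exact hxB (Finset.mem_filter.2 ⟨hxW.1, hc⟩)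
      simp only [huv, if_true, forall_const]
      rw [Finset.card_insert_of_notMem (by simp [hv]), pow_succ, mul_assoc]
      exact (hC u hu.2).trans (Nat.mul_le_mul_left _ hxB')
    · simpa [huv] using hC u hu.2

/-- If `H` does not embed in `G[W]`, then `W` contains a long sequence of large sets such that
every vertex of a later set has few neighbours in each earlier one. -/
theorem containsCopy_or_exists_sparse_chain [Fintype β] [Nonempty β] {H : SimpleGraph β} {Δ : ℕ}
    (hΔ : 0 < Δ) (hH : H.maxDegree ≤ Δ) (G : SimpleGraph α) {Q R : ℕ} (hQ : 0 < Q)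
    (hR : R = 2 * Δ * Q ^ Δ) (m : ℕ) (W : Finset α)
    (hW : 2 * R ^ m * Fintype.card β ≤ #W) :
    ContainsCopy G H ∨ ∃ X : ℕ → Finset α, (∀ i < m, X i ⊆ W ∧ 2 * Fintype.card β ≤ #(X i)) ∧
      ∀ j < m, ∀ i < j, ∀ x ∈ X j, Q * #{y ∈ X i | G.Adj x y} < #(X i) := by
  induction m generalizing W with
  | zero => exact Or.inr ⟨fun _ => ∅, by simp, by simp⟩
  | succ m ih =>
    have hQΔ : 0 < Q ^ Δ := by positivity
    have hRpos : 0 < R := by rw [hR]; positivity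
    have hQR : Q ^ Δ ≤ R ^ (m + 1) :=
      calc Q ^ Δ ≤ R := by rw [hR]; exact Nat.le_mul_of_pos_left _ (by positivity)
        _ ≤ R ^ (m + 1) := Nat.le_self_pow (by simp) _
    have hlarge : ∀ X : Finset α, #W ≤ R * #X → 2 * R ^ m * Fintype.card β ≤ #X := by
      intro X hX
      refine Nat.le_of_mul_le_mul_left ?_ hRpos
      calc R * (2 * R ^ m * Fintype.card β) = 2 * R ^ (m + 1) * Fintype.card β := by ring
        _ ≤ R * #X := hW.trans hX
    rcases containsCopy_or_exists_sparse_pair hΔ hH G hQ hR W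
      (le_trans (by gcongr) hW) with h | ⟨X, hXW, Y, hYW, hX, hY, hXY⟩
    · exact Or.inl h
    rcases ih X (hlarge X hX) with h | ⟨Z, hZ, hZZ⟩
    · exact Or.inl h
    refine Or.inr ⟨fun i => Nat.casesOn i Y Z, fun i hi => ?_, fun j hj i hij x hx => ?_⟩
    · cases i with
      | zero =>
        refine ⟨hYW, le_trans ?_ (hlarge Y hY)⟩
        exact Nat.mul_le_mul_right _ (Nat.le_mul_of_pos_right _ (by positivity))
      | succ i =>
        have := hZ i (by omega)
        exact ⟨this.1.trans hXW, this.2⟩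
    · cases j with
      | zero => omega
      | succ j =>
        cases i with
        | zero => exact hXY x ((hZ j (by omega)).1 hx)
        | succ i => exact hZZ j (by omega) i (by omega) x hx

/-- A sparse chain of `Δ + 1` sets hosts `H` in the complement, colour class by colour class. -/
theorem containsCopy_compl_of_sparse_chain [Fintype β] [Nonempty β] {H : SimpleGraph β} {Δ : ℕ}
    (hH : H.maxDegree ≤ Δ) (G : SimpleGraph α) (X : ℕ → Finset α)
    (hX : ∀ i < Δ + 1, 2 * Fintype.card β ≤ #(X i))
    (hXX : ∀ j < Δ + 1, ∀ i < j, ∀ x ∈ X j, 2 * Δ * #{y ∈ X i | G.Adj x y} < #(X i)) :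
    ContainsCopy Gᶜ H := by
  obtain ⟨φ, hφ, hφH⟩ := exists_coloring_lt_of_maxDegree_le hH
  have hβ : 0 < Fintype.card β := Fintype.card_pos
  suffices h : ∀ S : Finset β, ∃ f : β → α, IsPartialCopy Gᶜ H S f ∧ ∀ a ∈ S, f a ∈ X (φ a) by
    obtain ⟨f, hf, -⟩ := h Finset.univ
    exact hf.containsCopy
  intro S
  induction S using Finset.induction_on_min_value φ with
  | empty =>
    obtain ⟨x, -⟩ := Finset.card_pos.1 (lt_of_lt_of_le (by positivity) (hX 0 (by simp)))
    exact ⟨fun _ => x, ⟨by simp, by simp⟩, by simp⟩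
  | insert v S hv hmin ih =>
    obtain ⟨f, hf, hfX⟩ := ih
    let N : Finset β := {w ∈ S | H.Adj v w}
    let B (w : β) : Finset α := {y ∈ X (φ v) | G.Adj (f w) y}
    have hB : 2 * #(N.biUnion B) ≤ #(X (φ v)) := by
      by_cases hΔ : Δ = 0
      · have : #N ≤ Δ := card_filter_adj_le_of_maxDegree_le hH S v
        have : N = ∅ := by rw [← Finset.card_eq_zero]; omega
        simp [this]
      refine Nat.le_of_mul_le_mul_left ?_ (Nat.pos_of_ne_zero hΔ)
      calc Δ * (2 * #(N.biUnion B)) = 2 * Δ * #(N.biUnion B) := by ring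
        _ ≤ 2 * Δ * ∑ w ∈ N, #(B w) := Nat.mul_le_mul_left _ Finset.card_biUnion_le
        _ = ∑ w ∈ N, 2 * Δ * #(B w) := Finset.mul_sum _ _ _
        _ ≤ ∑ _w ∈ N, #(X (φ v)) := Finset.sum_le_sum fun w hw => by
            have hw := Finset.mem_filter.1 hw
            exact (hXX (φ w) (hφ w) (φ v) (lt_of_le_of_ne (hmin w hw.1) (hφH v w hw.2))
              (f w) (hfX w hw.1)).le
        _ = #N * #(X (φ v)) := by simp
        _ ≤ Δ * #(X (φ v)) :=
            Nat.mul_le_mul_right _ (card_filter_adj_le_of_maxDegree_le hH S v)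
    have hS : #(S.image f) < Fintype.card β :=
      Finset.card_image_le.trans_lt (Finset.card_lt_univ_of_notMem hv)
    obtain ⟨x, hxX, hx⟩ : ∃ x ∈ X (φ v), x ∉ N.biUnion B ∪ S.image f := by
      refine Finset.exists_mem_notMem_of_card_lt_card
        ((Finset.card_union_le _ _).trans_lt ?_)
      have := hX (φ v) (hφ v)
      omega
    rw [Finset.mem_union, not_or] at hx
    refine ⟨Function.update f v x, hf.update hv hx.2 fun b hb hvb => ?_, fun a ha => ?_⟩
    · rw [SimpleGraph.compl_adj]
      refine ⟨fun h => hx.2 (Finset.mem_image.2 ⟨b, hb, h⟩), fun h => hx.1 ?_⟩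
      exact Finset.mem_biUnion.2
        ⟨b, Finset.mem_filter.2 ⟨hb, hvb⟩, Finset.mem_filter.2 ⟨hxX, h⟩⟩
    · rcases Finset.mem_insert.1 ha with rfl | ha
      · simpa using hxX
      · rw [Function.update_of_ne (show a ≠ v from fun h => hv (h ▸ ha))]
        exact hfX a ha

end

/-- **Linear Ramsey numbers for bounded-degree graphs (Chvátal–Rödl–Szemerédi–Trotter).**
For every `Δ` there is a constant `c` such that for every graph `H` with maximum degree
at most `Δ` and every graph `G` on at least `c·|H|` vertices, `H` embeds in `G` or in
the complement of `G`. -/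
theorem linear_ramsey_bounded_degree (Δ : ℕ) (hΔ : 0 < Δ) :
    ∃ c : ℕ, ∀ (β : Type) [Fintype β] (H : SimpleGraph β),
      H.maxDegree ≤ Δ →
      ∀ (α : Type) [Fintype α] (G : SimpleGraph α),
        c * Fintype.card β ≤ Fintype.card α →
        ContainsCopy G H ∨ ContainsCopy Gᶜ H := by
  refine ⟨2 * (2 * Δ * (2 * Δ) ^ Δ) ^ (Δ + 1), fun β _ H hH α _ G hcard => ?_⟩
  rcases isEmpty_or_nonempty β with hβ | hβ
  · exact Or.inl ⟨fun b => hβ.elim b, fun b => hβ.elim b, fun b => hβ.elim b⟩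
  rcases containsCopy_or_exists_sparse_chain hΔ hH G (Q := 2 * Δ) (by positivity) rfl (Δ + 1)
    Finset.univ hcard with h | ⟨X, hX, hXX⟩
  · exact Or.inl h
  · exact Or.inr (containsCopy_compl_of_sparse_chain hH G X (fun i hi => (hX i hi).2) hXX)
end

section
/- For every η with 0 < η < 1/2 there exists an integer n₀ such that every graph G on n ≥ n₀ vertices with n divisible by 6 and minimum degree δ(G) ≥ (1/2 + η)n contains a perfect C₆-packing. -/
open Finset
open scoped Classical

/-- A perfect `C₆`-packing of `G`, encoded by a permutation `σ` of the vertices all of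
whose orbits are cycles of length exactly `6` and which moves every vertex along an
edge of `G`: the orbits are then pairwise vertex-disjoint cycles of length `6` in `G`
covering every vertex. -/
def HasPerfectC6Packing {V : Type*} (G : SimpleGraph V) : Prop :=
  ∃ σ : Equiv.Perm V,
    (∀ v : V, G.Adj v (σ v)) ∧
    (∀ v : V, (σ ^ 6) v = v) ∧
    (∀ v : V, ∀ i : ℕ, 0 < i → i < 6 → (σ ^ i) v ≠ v)

section Tilings

variable {V : Type*} {G : SimpleGraph V} {s t : Finset V}

/-- The vertex set `s` spans a cycle of length `6`. -/
def IsHexagon (G : SimpleGraph V) (s : Finset V) : Prop :=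
  ∃ f : Fin 6 → V, Function.Injective f ∧ (∀ i, G.Adj (f i) (f (i + 1))) ∧ univ.image f = s

/-- The vertex set `s` can be partitioned into sets spanning a cycle of length `6`. -/
def IsTileable (G : SimpleGraph V) (s : Finset V) : Prop :=
  ∃ 𝒞 : Finset (Finset V), (∀ C ∈ 𝒞, IsHexagon G C) ∧
    (𝒞 : Set (Finset V)).PairwiseDisjoint id ∧ 𝒞.biUnion id = s

theorem isHexagon_of_nodup {a b c d e g : V} (h : [a, b, c, d, e, g].Nodup)
    (hab : G.Adj a b) (hbc : G.Adj b c) (hcd : G.Adj c d) (hde : G.Adj d e) (heg : G.Adj e g)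
    (hga : G.Adj g a) : IsHexagon G {a, b, c, d, e, g} := by
  refine ⟨![a, b, c, d, e, g], ?_, ?_, ?_⟩
  · have := List.nodup_iff_injective_get.mp h
    intro i j hij
    refine this (a₁ := i) (a₂ := j) ?_
    fin_cases i <;> fin_cases j <;> exact hij
  · intro i
    fin_cases i <;> assumption
  · ext x
    simp [Fin.exists_fin_succ, eq_comm]

theorem IsHexagon.card (h : IsHexagon G s) : #s = 6 := by
  obtain ⟨f, hf, -, rfl⟩ := h
  simp [card_image_of_injective _ hf]

theorem IsHexagon.isTileable (h : IsHexagon G s) : IsTileable G s :=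
  ⟨{s}, by simpa using h, by simp, by simp⟩

theorem isTileable_empty : IsTileable G ∅ :=
  ⟨∅, by simp, by simp, by simp⟩

theorem IsTileable.union (hs : IsTileable G s) (ht : IsTileable G t) (hst : Disjoint s t) :
    IsTileable G (s ∪ t) := by
  obtain ⟨𝒞, h𝒞, hd𝒞, rfl⟩ := hs
  obtain ⟨𝒟, h𝒟, hd𝒟, rfl⟩ := ht
  refine ⟨𝒞 ∪ 𝒟, ?_, ?_, ?_⟩
  · intro C hC
    exact (mem_union.mp hC).elim (h𝒞 C) (h𝒟 C)
  · rw [coe_union]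
    refine (Set.pairwiseDisjoint_union).mpr ⟨hd𝒞, hd𝒟, fun C hC D hD _ => ?_⟩
    exact disjoint_of_subset_left (subset_biUnion_of_mem id hC)
      (disjoint_of_subset_right (subset_biUnion_of_mem id hD) hst)
  · ext
    simp [or_and_right, exists_or]

theorem card_biUnion_of_isHexagon {𝒞 : Finset (Finset V)} (h : ∀ C ∈ 𝒞, IsHexagon G C)
    (hd : (𝒞 : Set (Finset V)).PairwiseDisjoint id) : #(𝒞.biUnion id) = 6 * #𝒞 := by
  rw [card_biUnion hd, mul_comm]
  exact sum_const_nat fun C hC => (h C hC).card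

theorem IsTileable.six_dvd_card (h : IsTileable G s) : 6 ∣ #s := by
  obtain ⟨𝒞, h, hd, rfl⟩ := h
  exact ⟨_, card_biUnion_of_isHexagon h hd⟩

theorem IsTileable.exists_subset_card_eq (h : IsTileable G s) {j : ℕ} (hj : 6 * j ≤ #s) :
    ∃ t ⊆ s, IsTileable G t ∧ #t = 6 * j := by
  obtain ⟨𝒞, h, hd, rfl⟩ := h
  rw [card_biUnion_of_isHexagon h hd] at hj
  obtain ⟨𝒟, h𝒟, rfl⟩ := Finset.exists_subset_card_eq (show j ≤ #𝒞 by omega)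
  have hD : ∀ C ∈ 𝒟, IsHexagon G C := fun C hC => h C (h𝒟 hC)
  have hd' : (𝒟 : Set (Finset V)).PairwiseDisjoint id := hd.subset (coe_subset.mpr h𝒟)
  exact ⟨𝒟.biUnion id, biUnion_subset_biUnion_of_subset_left _ h𝒟, ⟨𝒟, hD, hd', rfl⟩,
    card_biUnion_of_isHexagon hD hd'⟩

theorem isTileable_triple_union {S P L : Finset V} {a b c : V} (ha : IsTileable G (insert a S))
    (hb : IsTileable G (insert b P)) (hc : IsTileable G (insert c L)) (hab : a ≠ b) (hac : a ≠ c)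
    (hbc : b ≠ c) (ha' : a ∉ S ∪ P ∪ L) (hb' : b ∉ S ∪ P ∪ L) (hc' : c ∉ S ∪ P ∪ L)
    (hSP : Disjoint S P) (hSL : Disjoint S L) (hPL : Disjoint P L) :
    IsTileable G ({a, b, c} ∪ (S ∪ P ∪ L)) := by
  simp only [mem_union, not_or] at ha' hb' hc'
  obtain ⟨⟨haS, haP⟩, haL⟩ := ha'
  obtain ⟨⟨hbS, hbP⟩, hbL⟩ := hb'
  obtain ⟨⟨hcS, hcP⟩, hcL⟩ := hc'
  convert (ha.union hb ?_).union hc ?_ using 1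
  · ext z
    simp only [mem_insert, mem_union, mem_singleton]
    tauto
  · simp only [disjoint_insert_left, disjoint_insert_right, mem_insert, not_or]
    exact ⟨⟨hab.symm, hbS⟩, haP, hSP⟩
  · simp only [disjoint_insert_right, disjoint_union_left, disjoint_insert_left, mem_union,
      mem_insert, not_or]
    exact ⟨⟨⟨hac.symm, hcS⟩, hbc.symm, hcP⟩, ⟨haL, hSL⟩, hbL, hPL⟩

theorem isHexagon_union_of_complete (hs : #s = 3) (ht : #t = 3) (hst : Disjoint s t)
    (h : ∀ x ∈ s, ∀ y ∈ t, G.Adj x y) : IsHexagon G (s ∪ t) := by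
  obtain ⟨a, c, e, hac, hae, hce, rfl⟩ := card_eq_three.mp hs
  obtain ⟨b, d, g, hbd, hbg, hdg, rfl⟩ := card_eq_three.mp ht
  have key : IsHexagon G {a, b, c, d, e, g} := by
    apply isHexagon_of_nodup
    · simp only [disjoint_insert_left, mem_insert, mem_singleton, disjoint_singleton_left] at hst
      simp only [List.nodup_cons, List.mem_cons, List.not_mem_nil]
      grind
    · exact h _ (by simp) _ (by simp)
    · exact (h _ (by simp) _ (by simp)).symm
    · exact h _ (by simp) _ (by simp)
    · exact (h _ (by simp) _ (by simp)).symm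
    · exact h _ (by simp) _ (by simp)
    · exact (h _ (by simp) _ (by simp)).symm
  convert key using 1
  ext
  simp only [mem_union, mem_insert, mem_singleton]
  tauto

theorem isTileable_union_of_complete {j : ℕ} (hs : #s = 3 * j) (ht : #t = 3 * j)
    (hst : Disjoint s t) (h : ∀ x ∈ s, ∀ y ∈ t, G.Adj x y) : IsTileable G (s ∪ t) := by
  induction j generalizing s t with
  | zero =>
    simp only [mul_zero, card_eq_zero] at hs ht
    subst hs ht
    exact isTileable_empty
  | succ j ih =>
    obtain ⟨s', hs's, hs'⟩ := exists_subset_card_eq (show 3 ≤ #s by omega)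
    obtain ⟨t', ht't, ht'⟩ := exists_subset_card_eq (show 3 ≤ #t by omega)
    have h1 : IsHexagon G (s' ∪ t') := isHexagon_union_of_complete hs' ht'
      (disjoint_of_subset_left hs's (disjoint_of_subset_right ht't hst))
      fun x hx y hy => h x (hs's hx) y (ht't hy)
    have h2 : IsTileable G (s \ s' ∪ t \ t') := by
      refine ih ?_ ?_ (disjoint_of_subset_left sdiff_subset
        (disjoint_of_subset_right sdiff_subset hst))
        fun x hx y hy => h x (mem_sdiff.mp hx).1 y (mem_sdiff.mp hy).1
      · rw [card_sdiff_of_subset hs's]; omega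
      · rw [card_sdiff_of_subset ht't]; omega
    have h3 : s ∪ t = (s' ∪ t') ∪ (s \ s' ∪ t \ t') := by
      ext x
      have := fun hx : x ∈ s' => hs's hx
      have := fun hx : x ∈ t' => ht't hx
      simp only [mem_union, mem_sdiff]
      tauto
    rw [h3]
    refine h1.isTileable.union h2 (disjoint_left.mpr fun x hx hx' => ?_)
    have := fun hx : x ∈ s' => hs's hx
    have := fun hx : x ∈ t' => ht't hx
    have := fun hx : x ∈ s => disjoint_left.mp hst hx
    simp only [mem_union, mem_sdiff] at hx hx'
    tauto

theorem IsHexagon.exists_perm (h : IsHexagon G s) :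
    ∃ σ : Equiv.Perm V, (∀ v ∉ s, σ v = v) ∧ ∀ v ∈ s, G.Adj v (σ v) ∧ (σ ^ 6) v = v ∧
      ∀ i : ℕ, 0 < i → i < 6 → (σ ^ i) v ≠ v := by
  obtain ⟨f, hf, hadj, rfl⟩ := h
  set σ : Equiv.Perm V := (Equiv.addRight (1 : Fin 6)).viaEmbedding ⟨f, hf⟩ with hσ
  have happ : ∀ j, σ (f j) = f (j + 1) := fun j =>
    Equiv.Perm.viaEmbedding_apply (Equiv.addRight (1 : Fin 6)) ⟨f, hf⟩ j
  have hpow : ∀ (i : ℕ) j, (σ ^ i) (f j) = f (j + i • 1) := by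
    intro i
    induction i with
    | zero => simp
    | succ i ih =>
      intro j
      rw [pow_succ', Equiv.Perm.mul_apply, ih, happ]
      rw [succ_nsmul, add_assoc]
  refine ⟨σ, fun v hv => ?_, fun v hv => ?_⟩
  · refine Equiv.Perm.viaEmbedding_apply_of_notMem _ ⟨f, hf⟩ v ?_
    simpa using hv
  · obtain ⟨j, -, rfl⟩ := mem_image.mp hv
    refine ⟨happ j ▸ hadj j, ?_, fun i hi hi6 => ?_⟩
    · rw [hpow, show 6 • (1 : Fin 6) = 0 from rfl, add_zero]
    · rw [hpow, hf.ne_iff]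
      interval_cases i <;> clear hv <;> revert j <;> decide

theorem IsTileable.exists_perm (h : IsTileable G s) :
    ∃ σ : Equiv.Perm V, (∀ v ∉ s, σ v = v) ∧ ∀ v ∈ s, G.Adj v (σ v) ∧ (σ ^ 6) v = v ∧
      ∀ i : ℕ, 0 < i → i < 6 → (σ ^ i) v ≠ v := by
  obtain ⟨𝒞, h, hd, rfl⟩ := h
  induction 𝒞 using Finset.induction_on with
  | empty => exact ⟨1, by simp, by simp⟩
  | insert C 𝒞 hC ih =>
    obtain ⟨σ, hσ, hσ'⟩ := (h C (mem_insert_self _ _)).exists_perm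
    obtain ⟨τ, hτ, hτ'⟩ := ih (fun D hD => h D (mem_insert_of_mem hD))
      (hd.subset (by simp))
    have hdisj : Disjoint C (𝒞.biUnion id) := by
      rw [disjoint_biUnion_right]
      intro D hD
      exact hd (by simp) (by simp [hD]) (by rintro rfl; exact hC hD)
    have hστ : σ.Disjoint τ := by
      intro v
      by_cases hv : v ∈ C
      · exact Or.inr (hτ v (disjoint_left.mp hdisj hv))
      · exact Or.inl (hσ v hv)
    have hpow : ∀ i : ℕ, (σ * τ) ^ i = σ ^ i * τ ^ i := fun i => hστ.commute.mul_pow i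
    refine ⟨σ * τ, fun v hv => ?_, fun v hv => ?_⟩
    · simp only [biUnion_insert, id, mem_union, not_or] at hv
      rw [Equiv.Perm.mul_apply, hτ v hv.2, hσ v hv.1]
    · rw [biUnion_insert, mem_union, id] at hv
      rcases hv with hv | hv
      · have hfix := hτ v (disjoint_left.mp hdisj hv)
        have hfixp : ∀ i : ℕ, (τ ^ i) v = v := fun i =>
          Equiv.Perm.pow_apply_eq_self_of_apply_eq_self hfix i
        simpa only [hpow, Equiv.Perm.mul_apply, hfix, hfixp] using hσ' v hv
      · have hfix := hσ v (disjoint_right.mp hdisj hv)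
        have hfixp : ∀ i : ℕ, (σ ^ i) v = v := fun i =>
          Equiv.Perm.pow_apply_eq_self_of_apply_eq_self hfix i
        rw [hστ.commute.eq]
        have hpow' : ∀ i : ℕ, (τ * σ) ^ i = τ ^ i * σ ^ i := fun i => hστ.symm.commute.mul_pow i
        simpa only [hpow', Equiv.Perm.mul_apply, hfix, hfixp] using hτ' v hv

theorem IsTileable.hasPerfectC6Packing [Fintype V] (h : IsTileable G univ) :
    HasPerfectC6Packing G := by
  obtain ⟨σ, -, hσ⟩ := h.exists_perm
  exact ⟨σ, fun v => (hσ v (mem_univ v)).1, fun v => (hσ v (mem_univ v)).2.1,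
    fun v => (hσ v (mem_univ v)).2.2⟩

end Tilings

section Absorption

variable {V : Type*} [Fintype V] {G : SimpleGraph V} {η : ℝ}

theorem sum_card_inter_neighborFinset_comm (s t : Finset V) :
    ∑ u ∈ s, #(t ∩ G.neighborFinset u) = ∑ v ∈ t, #(s ∩ G.neighborFinset v) := by
  convert sum_card_bipartiteAbove_eq_sum_card_bipartiteBelow (s := s) (t := t) G.Adj
    using 2 with a _ x _
  · congr 1
    ext y
    simp [bipartiteAbove]
  · congr 1
    ext y
    simp [bipartiteBelow, G.adj_comm]

theorem le_card_inter_neighborFinset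
    (hG : ∀ v, (1 / 2 + η) * Fintype.card V ≤ #(G.neighborFinset v)) (a b : V) :
    2 * η * Fintype.card V ≤ #(G.neighborFinset a ∩ G.neighborFinset b) := by
  have h1 := card_union_add_card_inter (G.neighborFinset a) (G.neighborFinset b)
  have h2 := card_le_univ (G.neighborFinset a ∪ G.neighborFinset b)
  have h3 : (#(G.neighborFinset a) + #(G.neighborFinset b) : ℝ) ≤
      Fintype.card V + #(G.neighborFinset a ∩ G.neighborFinset b) := by
    exact_mod_cast (by omega)
  have := hG a
  have := hG b
  linarith

theorem exists_common_neighbor_notMem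
    (hG : ∀ v, (1 / 2 + η) * Fintype.card V ≤ #(G.neighborFinset v)) (a b : V) {F : Finset V}
    (hF : #F < 2 * η * Fintype.card V) : ∃ x ∉ F, G.Adj a x ∧ G.Adj b x := by
  have h1 := hF.trans_le (le_card_inter_neighborFinset hG a b)
  obtain ⟨x, hx, hxF⟩ := exists_mem_notMem_of_card_lt_card (by exact_mod_cast h1)
  simp only [mem_inter, SimpleGraph.mem_neighborFinset] at hx
  exact ⟨x, hxF, hx⟩

/-- Two vertices `a`, `b` outside a small set `F` are the ends of a path on five vertices which
avoids `F`; a further common neighbour of `a` and `b` closes this path to a hexagon. -/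
theorem exists_path_of_ends
    (hG : ∀ v, (1 / 2 + η) * Fintype.card V ≤ #(G.neighborFinset v)) {a b : V} (hab : a ≠ b)
    {F : Finset V} (haF : a ∉ F) (hbF : b ∉ F) (hF : #F + 4 < 2 * η * Fintype.card V) :
    ∃ S : Finset V, #S = 5 ∧ Disjoint S F ∧
      ∀ x ∉ S, G.Adj a x → G.Adj b x → IsHexagon G (insert x S) := by
  have small : ∀ {F' : Finset V}, #F' ≤ #F + 4 → (#F' : ℝ) < 2 * η * Fintype.card V := by
    intro F' h
    have : (#F' : ℝ) ≤ #F + 4 := by exact_mod_cast h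
    linarith
  obtain ⟨p, hp, hap, -⟩ := exists_common_neighbor_notMem hG a a (F := insert a (insert b F))
    (small (by grind [card_insert_le]))
  obtain ⟨r, hr, hbr, -⟩ := exists_common_neighbor_notMem hG b b
    (F := insert p (insert a (insert b F))) (small (by grind [card_insert_le]))
  obtain ⟨q, hq, hpq, hrq⟩ := exists_common_neighbor_notMem hG p r
    (F := insert r (insert p (insert a (insert b F)))) (small (by grind [card_insert_le]))
  simp only [mem_insert, not_or] at hp hr hq
  refine ⟨{a, p, q, r, b}, ?_, ?_, ?_⟩
  · repeat rw [card_insert_of_notMem (by simp only [mem_insert, mem_singleton]; grind)]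
    rfl
  · simp only [disjoint_insert_left, disjoint_singleton_left]
    tauto
  · intro x hx hax hbx
    simp only [mem_insert, mem_singleton, not_or] at hx
    refine isHexagon_of_nodup ?_ hax.symm hap hpq hrq.symm hbr.symm hbx
    simp only [List.nodup_cons, List.mem_cons, List.not_mem_nil]
    grind

/-- Any two vertices can be completed to a hexagon by the same five vertices. -/
theorem exists_common_completion
    (hG : ∀ v, (1 / 2 + η) * Fintype.card V ≤ #(G.neighborFinset v)) (y w : V)
    {F : Finset V} (hF : #F + 7 < 2 * η * Fintype.card V) :
    ∃ L : Finset V, #L = 5 ∧ Disjoint L F ∧ y ∉ L ∧ w ∉ L ∧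
      IsHexagon G (insert y L) ∧ IsHexagon G (insert w L) := by
  have small : ∀ {F' : Finset V} {c : ℕ}, #F' ≤ #F + c → c ≤ 7 →
      (#F' : ℝ) + (7 - c) < 2 * η * Fintype.card V := by
    intro F' c h _
    have : (#F' : ℝ) ≤ #F + c := by exact_mod_cast h
    linarith
  have hc2 : #(insert y (insert w F)) ≤ #F + 2 := by grind [card_insert_le]
  obtain ⟨a, ha, hya, hwa⟩ := exists_common_neighbor_notMem hG y w (F := insert y (insert w F))
    (by have := small hc2 (by norm_num); push_cast at this; linarith)
  obtain ⟨b, hb, hyb, hwb⟩ := exists_common_neighbor_notMem hG y w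
    (F := insert a (insert y (insert w F)))
    (by
      have := small (F' := insert a (insert y (insert w F))) (c := 3)
        (by grind [card_insert_le]) (by norm_num)
      push_cast at this
      linarith)
  obtain ⟨L, hL, hLF, hx⟩ := exists_path_of_ends hG (a := a) (b := b) (by grind)
    (F := insert y (insert w F)) ha (by grind)
    (by have := small hc2 (by norm_num); push_cast at this; linarith)
  simp only [disjoint_insert_right] at hLF
  exact ⟨L, hL, hLF.2.2, hLF.1, hLF.2.1, hx y hLF.1 hya.symm hyb.symm,
    hx w hLF.2.1 hwa.symm hwb.symm⟩

/-- Some vertex outside a small set `F` is adjacent to at least half of `B`. -/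
theorem exists_notMem_card_le_two_mul_card_inter (hη1 : η < 1 / 2)
    (hG : ∀ v, (1 / 2 + η) * Fintype.card V ≤ #(G.neighborFinset v)) (B : Finset V)
    {F : Finset V} (hF : #F < η * Fintype.card V) :
    ∃ a ∉ F, #B ≤ 2 * #(B ∩ G.neighborFinset a) := by
  by_contra! hcon
  have hn : (0 : ℝ) ≤ Fintype.card V := by positivity
  have hF' : #F < Fintype.card V := by
    have : (#F : ℝ) < Fintype.card V := by nlinarith
    exact_mod_cast this
  have hne : (Fᶜ).Nonempty := by
    rw [← card_pos, card_compl]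
    omega
  have h1 : ∑ a ∈ Fᶜ, 2 * #(B ∩ G.neighborFinset a) < ∑ a ∈ Fᶜ, #B :=
    sum_lt_sum_of_nonempty hne fun a ha => hcon a (mem_compl.mp ha)
  have h3 : ∀ x ∈ B, (Fintype.card V / 2 : ℝ) ≤ #(Fᶜ ∩ G.neighborFinset x) := by
    intro x _
    have h4 : #(G.neighborFinset x) ≤ #(Fᶜ ∩ G.neighborFinset x) + #F := by
      have := card_le_card (show G.neighborFinset x ⊆ (Fᶜ ∩ G.neighborFinset x) ∪ F by
        intro y hy
        simp only [mem_union, mem_inter, mem_compl]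
        tauto)
      exact this.trans (card_union_le _ _)
    have h5 : (#(G.neighborFinset x) : ℝ) ≤ #(Fᶜ ∩ G.neighborFinset x) + #F := by
      exact_mod_cast h4
    linarith [hG x]
  have h6 := sum_le_sum h3
  rw [← mul_sum, sum_card_inter_neighborFinset_comm, sum_const, smul_eq_mul] at h1
  rw [sum_const, nsmul_eq_mul] at h6
  have h7 : #(Fᶜ) ≤ Fintype.card V := card_le_univ _
  have h8 : 2 * ∑ x ∈ B, #(Fᶜ ∩ G.neighborFinset x) < Fintype.card V * #B :=
    h1.trans_le (Nat.mul_le_mul_right _ h7)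
  have h9 : (2 * ∑ x ∈ B, #(Fᶜ ∩ G.neighborFinset x) : ℝ) < Fintype.card V * #B := by
    exact_mod_cast h8
  push_cast at h9
  linarith

/-- A path on five vertices, avoiding a small set `F`, that extends to a hexagon by many vertices,
in particular by a quarter of the vertices in `B`. -/
theorem exists_path_extending (hη1 : η < 1 / 2)
    (hG : ∀ v, (1 / 2 + η) * Fintype.card V ≤ #(G.neighborFinset v)) (B : Finset V)
    {F : Finset V} (hF : #F + 4 < η * Fintype.card V) :
    ∃ S X : Finset V, #S = 5 ∧ Disjoint S F ∧ (∀ x ∈ X, x ∉ S → IsHexagon G (insert x S)) ∧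
      2 * η * Fintype.card V ≤ #X ∧ #B ≤ 4 * #(B ∩ X) := by
  have hF0 : (0 : ℝ) ≤ #F := by positivity
  obtain ⟨a, ha, haB⟩ := exists_notMem_card_le_two_mul_card_inter hη1 hG B (F := F) (by linarith)
  obtain ⟨b, hb, hbB⟩ := exists_notMem_card_le_two_mul_card_inter hη1 hG
    (B ∩ G.neighborFinset a) (F := insert a F) (by
      have : (#(insert a F) : ℝ) ≤ #F + 1 := by exact_mod_cast card_insert_le a F
      linarith)
  obtain ⟨S, hS, hSF, hx⟩ := exists_path_of_ends hG (a := a) (b := b) (by grind) (F := F) ha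
    (by grind) (by linarith)
  refine ⟨S, G.neighborFinset a ∩ G.neighborFinset b, hS, hSF, fun x hxX hxS => ?_,
    le_card_inter_neighborFinset hG a b, ?_⟩
  · simp only [mem_inter, SimpleGraph.mem_neighborFinset] at hxX
    exact hx x hxS hxX.1 hxX.2
  · rw [← inter_assoc]
    omega

/-- A small set `S` avoiding `F` such that `S` together with any further vertex is tileable, for
all but a `(3 / 4) ^ k` proportion of the vertices. -/
theorem exists_set_completed_by_most (hη1 : η < 1 / 2)
    (hG : ∀ v, (1 / 2 + η) * Fintype.card V ≤ #(G.neighborFinset v)) {F : Finset V} (k : ℕ)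
    (hF : #F + 12 * k + 30 < η * Fintype.card V) :
    ∃ S B : Finset V, #S = 12 * k + 5 ∧ Disjoint S F ∧
      (∀ x ∉ B, x ∉ S → IsTileable G (insert x S)) ∧
      2 * η * Fintype.card V + #B ≤ Fintype.card V ∧
      4 ^ k * #B ≤ 3 ^ k * Fintype.card V := by
  have hF0 : (0 : ℝ) ≤ #F := by positivity
  induction k with
  | zero =>
    push_cast at hF
    obtain ⟨S, X, hS, hSF, hSX, hX, -⟩ := exists_path_extending hη1 hG univ (F := F) (by linarith)
    refine ⟨S, Xᶜ, by omega, hSF, fun x hx hxS => (hSX x (by simpa using hx) hxS).isTileable,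
      ?_, by simpa using card_le_univ Xᶜ⟩
    have : (#X + #Xᶜ : ℝ) = Fintype.card V := by exact_mod_cast card_add_card_compl X
    linarith
  | succ k ih =>
    push_cast at hF
    obtain ⟨S, B, hS, hSF, hSB, hB, hBk⟩ := ih (by linarith)
    have hS' : (#S : ℝ) = 12 * k + 5 := by exact_mod_cast hS
    have hFS : (#(F ∪ S) : ℝ) ≤ #F + #S := by exact_mod_cast card_union_le F S
    obtain ⟨P, X, hP, hPF, hPX, hX, hBX⟩ := exists_path_extending hη1 hG B (F := F ∪ S)
      (by linarith)
    have hFSP : (#((F ∪ S) ∪ P) : ℝ) ≤ #(F ∪ S) + 5 := by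
      exact_mod_cast hP ▸ card_union_le (F ∪ S) P
    obtain ⟨y, -, hy⟩ : ∃ y ∈ (univ : Finset V), y ∉ B ∪ ((F ∪ S) ∪ P) := by
      apply exists_mem_notMem_of_card_lt_card
      have : (#(B ∪ ((F ∪ S) ∪ P)) : ℝ) ≤ #B + #((F ∪ S) ∪ P) := by
        exact_mod_cast card_union_le _ _
      have : (#(B ∪ ((F ∪ S) ∪ P)) : ℝ) < Fintype.card V := by linarith
      rw [card_univ]
      exact_mod_cast this
    obtain ⟨w, hwX, hw⟩ : ∃ w ∈ X, w ∉ insert y ((F ∪ S) ∪ P) := by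
      apply exists_mem_notMem_of_card_lt_card
      have : (#(insert y ((F ∪ S) ∪ P)) : ℝ) ≤ #((F ∪ S) ∪ P) + 1 := by
        exact_mod_cast card_insert_le _ _
      have : (#(insert y ((F ∪ S) ∪ P)) : ℝ) < #X := by linarith
      exact_mod_cast this
    obtain ⟨L, hL, hLF, hyL, hwL, hLy, hLw⟩ := exists_common_completion hG y w
      (F := (F ∪ S) ∪ P) (by linarith)
    simp only [mem_union, mem_insert, not_or] at hy hw
    obtain ⟨hyB, ⟨hyF, hyS⟩, hyP⟩ := hy
    obtain ⟨hwy, ⟨hwF, hwS⟩, hwP⟩ := hw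
    simp only [disjoint_union_right] at hPF hLF
    obtain ⟨⟨hLF, hLS⟩, hLP⟩ := hLF
    obtain ⟨hPF, hPS⟩ := hPF
    have hyw : Disjoint {y, w} (S ∪ P ∪ L) := by
      simp only [disjoint_insert_left, disjoint_singleton_left, mem_union, not_or]
      exact ⟨⟨⟨hyS, hyP⟩, hyL⟩, ⟨hwS, hwP⟩, hwL⟩
    refine ⟨{y, w} ∪ (S ∪ P ∪ L), B \ X, ?_, ?_, ?_, ?_, ?_⟩
    · rw [card_union_of_disjoint hyw, card_pair (Ne.symm hwy), card_union_of_disjoint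
        (disjoint_union_left.mpr ⟨hLS.symm, hLP.symm⟩), card_union_of_disjoint hPS.symm]
      omega
    · simp only [disjoint_insert_left, disjoint_union_left, disjoint_singleton_left]
      exact ⟨⟨hyF, hwF⟩, ⟨hSF, hPF⟩, hLF⟩
    · intro x hxB hx
      simp only [mem_sdiff, not_and, not_not] at hxB
      rw [mem_union, not_or] at hx
      obtain ⟨hxyw, hxT⟩ := hx
      simp only [mem_insert, mem_singleton, not_or] at hxyw
      obtain ⟨hxy, hxw⟩ := hxyw
      have hyT := disjoint_left.mp hyw (mem_insert_self y {w})
      have hwT := disjoint_left.mp hyw (mem_insert_of_mem (mem_singleton_self w))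
      rw [← insert_union]
      by_cases hxX : x ∈ X
      · have hxP : x ∉ P := fun h => hxT (by simp [h])
        rw [insert_comm x y]
        exact isTileable_triple_union (hSB y hyB hyS) (hPX x hxX hxP).isTileable hLw.isTileable
          (Ne.symm hxy) (Ne.symm hwy) hxw hyT hxT hwT hPS.symm hLS.symm hLP.symm
      · have hxS : x ∉ S := fun h => hxT (by simp [h])
        rw [pair_comm y w]
        exact isTileable_triple_union (hSB x (fun h => hxX (hxB h)) hxS)
          (hPX w hwX hwP).isTileable hLy.isTileable
          hxw hxy hwy hxT hwT hyT hPS.symm hLS.symm hLP.symm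
    · have : (#(B \ X) : ℝ) ≤ #B := by exact_mod_cast card_le_card sdiff_subset
      linarith
    · have h1 := card_sdiff_add_card_inter B X
      have h2 : 4 * #(B \ X) ≤ 3 * #B := by omega
      calc 4 ^ (k + 1) * #(B \ X) = 4 ^ k * (4 * #(B \ X)) := by ring
        _ ≤ 4 ^ k * (3 * #B) := Nat.mul_le_mul_left _ h2
        _ = 3 * (4 ^ k * #B) := by ring
        _ ≤ 3 * (3 ^ k * Fintype.card V) := Nat.mul_le_mul_left _ hBk
        _ = 3 ^ (k + 1) * Fintype.card V := by ring

/-- A small absorbing set: together with any `m` further vertices it is tileable. -/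
theorem exists_absorbing_set (hη1 : η < 1 / 2)
    (hG : ∀ v, (1 / 2 + η) * Fintype.card V ≤ #(G.neighborFinset v)) {k : ℕ}
    (hk : 3 ^ k * Fintype.card V < 4 ^ k) (m : ℕ)
    (hm : (m + 1 : ℝ) * (12 * k + 30) < η * Fintype.card V) :
    ∃ A : Finset V, #A = m * (12 * k + 5) ∧
      ∀ U : Finset V, Disjoint U A → #U = m → IsTileable G (U ∪ A) := by
  induction m with
  | zero =>
    refine ⟨∅, by simp, fun U _ hU => ?_⟩
    rw [card_eq_zero.mp hU, union_empty]
    exact isTileable_empty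
  | succ m ih =>
    push_cast at hm
    have hk0 : (0 : ℝ) ≤ k := by positivity
    obtain ⟨A, hA, hAU⟩ := ih (by linarith)
    have hA' : (#A : ℝ) = m * (12 * k + 5) := by exact_mod_cast hA
    obtain ⟨S, B, hS, hSA, hSB, -, hB⟩ := exists_set_completed_by_most hη1 hG (F := A) k
      (by rw [hA']; nlinarith [(by positivity : (0 : ℝ) ≤ m)])
    have hB0 : #B = 0 := by
      by_contra hne
      have := Nat.mul_le_mul_left (4 ^ k) (Nat.one_le_iff_ne_zero.mpr hne)
      omega
    refine ⟨S ∪ A, by rw [card_union_of_disjoint hSA]; linarith, fun U hU hUm => ?_⟩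
    obtain ⟨x, U, hxU, rfl, hUm'⟩ := card_eq_succ.mp hUm
    simp only [disjoint_insert_left, disjoint_union_right] at hU
    obtain ⟨⟨hxS, hUS⟩, hxA, hUA⟩ := hU
    have hx := hSB x (by simp [card_eq_zero.mp hB0]) hxS
    convert hx.union (hAU U hUA hUm') ?_ using 1
    · ext
      simp only [mem_insert, mem_union]
      tauto
    · simp only [disjoint_insert_left, disjoint_union_right]
      have := hUS.symm
      tauto

end Absorption

section AlmostTiling

variable {V : Type*} {G : SimpleGraph V}

theorem exists_three_le_fiber {α β : Type*} {s : Finset α} {t : Finset β} {f : α → β}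
    (hf : ∀ a ∈ s, f a ∈ t) (h : 2 * #t < #s) :
    ∃ y ∈ t, ∃ D ⊆ s, #D = 3 ∧ ∀ a ∈ D, f a = y := by
  obtain ⟨y, hy, hys⟩ := exists_lt_card_fiber_of_mul_lt_card_of_maps_to (n := 2) hf
    (by rwa [mul_comm])
  obtain ⟨D, hD, hD3⟩ := exists_subset_card_eq (show 3 ≤ #{a ∈ s | f a = y} from hys)
  exact ⟨y, hy, D, fun a ha => (mem_filter.mp (hD ha)).1, hD3,
    fun a ha => (mem_filter.mp (hD ha)).2⟩

variable [Fintype V]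

/-- Many vertices with at least three neighbours in `U` yield a hexagon. -/
theorem exists_isHexagon_of_card_lt {U W : Finset V} (hUW : Disjoint U W)
    (hW : ∀ v ∈ W, 3 ≤ #(U ∩ G.neighborFinset v)) (h : 2 * 2 ^ #U < #W) :
    ∃ s ⊆ U ∪ W, IsHexagon G s := by
  obtain ⟨P, hP, D, hDW, hD, hDP⟩ := exists_three_le_fiber (s := W) (t := U.powerset)
    (f := fun v => U ∩ G.neighborFinset v) (fun v _ => mem_powerset.mpr inter_subset_left)
    (by rwa [card_powerset])
  obtain ⟨v, hv⟩ := card_pos.mp (show 0 < #D by omega)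
  obtain ⟨Q, hQP, hQ⟩ := exists_subset_card_eq (show 3 ≤ #P from hDP v hv ▸ hW v (hDW hv))
  have hQU : Q ⊆ U := hQP.trans (mem_powerset.mp hP)
  refine ⟨Q ∪ D, union_subset_union hQU hDW, isHexagon_union_of_complete hQ hD
    (disjoint_of_subset_left hQU (disjoint_of_subset_right hDW hUW)) fun x hx y hy => ?_⟩
  have := hDP y hy ▸ hQP hx
  simp only [mem_inter, SimpleGraph.mem_neighborFinset] at this
  exact this.2.symm

/-- If many hexagons of a packing contain four vertices with twelve common neighbours in `U`, then
three of these hexagons and twelve vertices of `U` can be rearranged into a larger packing. -/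
theorem exists_larger_tileable {𝒞 ℋ : Finset (Finset V)} (h𝒞 : ∀ C ∈ 𝒞, IsHexagon G C)
    (hd : (𝒞 : Set (Finset V)).PairwiseDisjoint id) {U : Finset V}
    (hU : Disjoint U (𝒞.biUnion id)) (hℋ𝒞 : ℋ ⊆ 𝒞)
    (hℋ : ∀ C ∈ ℋ, ∃ S ⊆ C, #S = 4 ∧ 12 ≤ #{u ∈ U | S ⊆ G.neighborFinset u})
    (h : 2 * 2 ^ #U < #ℋ) :
    ∃ T ⊆ 𝒞.biUnion id ∪ U, IsTileable G T ∧ #(𝒞.biUnion id) < #T := by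
  choose! S hSC hS hSU using hℋ
  obtain ⟨P, hP, D, hDℋ, hD, hDP⟩ := exists_three_le_fiber (s := ℋ) (t := U.powerset)
    (f := fun C => {u ∈ U | S C ⊆ G.neighborFinset u})
    (fun v _ => mem_powerset.mpr (filter_subset _ _)) (by rwa [card_powerset])
  obtain ⟨C₀, hC₀⟩ := card_pos.mp (show 0 < #D by omega)
  obtain ⟨Q, hQP, hQ⟩ := exists_subset_card_eq (show 12 ≤ #P from hDP C₀ hC₀ ▸ hSU C₀ (hDℋ hC₀))
  have hQU : Q ⊆ U := hQP.trans (mem_powerset.mp hP)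
  have hD𝒞 : D ⊆ 𝒞 := hDℋ.trans hℋ𝒞
  have hSD : D.biUnion S ⊆ D.biUnion id := biUnion_mono fun C hC => hSC C (hDℋ hC)
  have hX : #(D.biUnion S) = 12 := by
    rw [card_biUnion, sum_const_nat (m := 4) fun C hC => hS C (hDℋ hC), hD]
    intro C hC C' hC' hne
    exact disjoint_of_subset_left (hSC C (hDℋ hC)) (disjoint_of_subset_right (hSC C' (hDℋ hC'))
      (hd (hD𝒞 hC) (hD𝒞 hC') hne))
  have hrest : ∀ C ∈ 𝒞 \ D, IsHexagon G C := fun C hC => h𝒞 C (mem_sdiff.mp hC).1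
  have hrestd : ((𝒞 \ D : Finset (Finset V)) : Set (Finset V)).PairwiseDisjoint id :=
    hd.subset (coe_subset.mpr sdiff_subset)
  have hsub : (𝒞 \ D).biUnion id ⊆ 𝒞.biUnion id :=
    biUnion_subset_biUnion_of_subset_left _ sdiff_subset
  have hsub' : D.biUnion id ⊆ 𝒞.biUnion id := biUnion_subset_biUnion_of_subset_left _ hD𝒞
  have hXQ : Disjoint (D.biUnion S) Q :=
    disjoint_of_subset_left (hSD.trans hsub') (disjoint_of_subset_right hQU hU.symm)
  have hnew : IsTileable G (D.biUnion S ∪ Q) := by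
    refine isTileable_union_of_complete (j := 4) hX hQ hXQ fun x hx y hy => ?_
    obtain ⟨C, hC, hxC⟩ := mem_biUnion.mp hx
    have hy' := hQP hy
    rw [← hDP C hC, mem_filter] at hy'
    exact ((G.mem_neighborFinset _ _).mp (hy'.2 hxC)).symm
  have hdisj : Disjoint ((𝒞 \ D).biUnion id) (D.biUnion S ∪ Q) := by
    refine disjoint_union_right.mpr ⟨disjoint_of_subset_right hSD ?_,
      disjoint_of_subset_left hsub (disjoint_of_subset_right hQU hU.symm)⟩
    simp only [disjoint_biUnion_left, disjoint_biUnion_right]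
    intro C hC C' hC'
    obtain ⟨hC'𝒞, hC'D⟩ := mem_sdiff.mp hC'
    exact hd hC'𝒞 (hD𝒞 hC) (by rintro rfl; exact hC'D hC)
  refine ⟨(𝒞 \ D).biUnion id ∪ (D.biUnion S ∪ Q), ?_, IsTileable.union ⟨_, hrest, hrestd, rfl⟩
    hnew hdisj, ?_⟩
  · exact union_subset (hsub.trans subset_union_left) (union_subset
      ((hSD.trans hsub').trans subset_union_left) (hQU.trans subset_union_right))
  · rw [card_union_of_disjoint hdisj, card_union_of_disjoint hXQ, hX, hQ,
      card_biUnion_of_isHexagon hrest hrestd, card_biUnion_of_isHexagon h𝒞 hd,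
      card_sdiff_of_subset hD𝒞, hD]
    have := card_le_card hD𝒞
    omega

/-- A six-set in which no four vertices have twelve common neighbours in `U` sends few edges
to `U`. -/
theorem sum_card_inter_neighborFinset_le {U C : Finset V} (hC : #C = 6)
    (h : ∀ S ⊆ C, #S = 4 → #{u ∈ U | S ⊆ G.neighborFinset u} ≤ 11) :
    ∑ v ∈ C, #(U ∩ G.neighborFinset v) ≤ 3 * #U + 495 := by
  rw [sum_card_inter_neighborFinset_comm]
  have h1 : #{u ∈ U | 4 ≤ #(C ∩ G.neighborFinset u)} ≤ 165 := by
    have hsub : {u ∈ U | 4 ≤ #(C ∩ G.neighborFinset u)} ⊆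
        (powersetCard 4 C).biUnion fun S => {u ∈ U | S ⊆ G.neighborFinset u} := by
      intro u hu
      obtain ⟨hu, hu4⟩ := mem_filter.mp hu
      obtain ⟨S, hS, hS4⟩ := exists_subset_card_eq hu4
      exact mem_biUnion.mpr ⟨S, mem_powersetCard.mpr ⟨hS.trans inter_subset_left, hS4⟩,
        mem_filter.mpr ⟨hu, hS.trans inter_subset_right⟩⟩
    refine (card_le_card hsub).trans ((card_biUnion_le_card_mul _ _ 11 fun S hS => ?_).trans ?_)
    · exact h S (mem_powersetCard.mp hS).1 (mem_powersetCard.mp hS).2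
    · rw [card_powersetCard, hC]
      decide
  have h2 : ∀ u ∈ U, #(C ∩ G.neighborFinset u) ≤
      3 + if 4 ≤ #(C ∩ G.neighborFinset u) then 3 else 0 := by
    intro u _
    have := card_le_card (inter_subset_left (s₁ := C) (s₂ := G.neighborFinset u))
    split_ifs <;> omega
  refine (sum_le_sum h2).trans ?_
  rw [sum_add_distrib, ← sum_filter, sum_const, sum_const]
  simp only [smul_eq_mul]
  omega

/-- If every vertex has slightly more than `n / 2` neighbours in `R`, then `R` contains a tileable
set missing only a bounded number of vertices. -/
theorem exists_tileable_card_sdiff_lt {η : ℝ} {K : ℕ} (hK : 400 ≤ K * η) (hK6 : 6 ≤ K)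
    {R : Finset V} (hR : ∀ v, (1 / 2 + η / 2) * Fintype.card V ≤ #(R ∩ G.neighborFinset v))
    (hn : K * (14 * 2 ^ K + K) < Fintype.card V) :
    ∃ T ⊆ R, IsTileable G T ∧ #(R \ T) < K := by
  obtain ⟨T, hT, hmax⟩ := exists_max_image {T ∈ R.powerset | IsTileable G T} card
    ⟨∅, by simp [isTileable_empty]⟩
  simp only [mem_filter, mem_powerset] at hT hmax
  obtain ⟨hTR, hTt⟩ := hT
  refine ⟨T, hTR, hTt, ?_⟩
  by_contra! hKT
  obtain ⟨U, hUR, hU⟩ := exists_subset_card_eq hKT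
  obtain ⟨𝒞, h𝒞, hd, rfl⟩ := id hTt
  set T := 𝒞.biUnion id with hTdef
  have hUT : Disjoint U T := disjoint_of_subset_left hUR sdiff_disjoint
  set W := {v ∈ (R \ T) \ U | 3 ≤ #(U ∩ G.neighborFinset v)} with hW
  have hWcard : #W ≤ 2 * 2 ^ K := by
    by_contra! hlt
    obtain ⟨s, hs, hhex⟩ := exists_isHexagon_of_card_lt (G := G) (U := U) (W := W)
      (disjoint_sdiff.mono_right (filter_subset _ _)) (fun v hv => (mem_filter.mp hv).2) (hU ▸ hlt)
    have hsR : s ⊆ R \ T :=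
      hs.trans (union_subset hUR ((filter_subset _ _).trans sdiff_subset))
    have hTs : Disjoint T s := disjoint_of_subset_right hsR disjoint_sdiff
    have := hmax (T ∪ s) ⟨union_subset hTR (hsR.trans sdiff_subset),
      hTt.union hhex.isTileable hTs⟩
    rw [card_union_of_disjoint hTs, hhex.card] at this
    omega
  set ℋ := {C ∈ 𝒞 | ∃ S ⊆ C, #S = 4 ∧ 12 ≤ #{u ∈ U | S ⊆ G.neighborFinset u}} with hℋ
  have hℋcard : #ℋ ≤ 2 * 2 ^ K := by
    by_contra! hlt
    obtain ⟨T', hT'sub, hT't, hlt'⟩ := exists_larger_tileable h𝒞 hd hUT (filter_subset _ _)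
      (fun C hC => (mem_filter.mp hC).2) (hU ▸ hlt)
    exact absurd (hmax T' ⟨hT'sub.trans (union_subset hTR (hUR.trans sdiff_subset)), hT't⟩)
      (not_le.mpr hlt')
  have hle : ∀ v, #(U ∩ G.neighborFinset v) ≤ K := fun v => hU ▸ card_le_card inter_subset_left
  have hout : ∑ v ∈ R \ T, #(U ∩ G.neighborFinset v) ≤ 2 * #(R \ T) + K * (2 * 2 ^ K + K) := by
    have h1 : ∀ v ∈ R \ T, #(U ∩ G.neighborFinset v) ≤ 2 + if v ∈ W ∪ U then K else 0 := by
      intro v hv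
      have := hle v
      split_ifs with hvW
      · omega
      · simp only [mem_union, hW, mem_filter, mem_sdiff, not_or, not_and, not_le] at hvW hv
        have := hvW.1 ⟨hv, hvW.2⟩
        omega
    refine (sum_le_sum h1).trans ?_
    rw [sum_add_distrib, ← sum_filter, sum_const, sum_const, smul_eq_mul, smul_eq_mul,
      mul_comm _ 2, mul_comm _ K]
    have h2 : #{v ∈ R \ T | v ∈ W ∪ U} ≤ 2 * 2 ^ K + K :=
      calc #{v ∈ R \ T | v ∈ W ∪ U} ≤ #(W ∪ U) :=
            card_le_card fun v hv => (mem_filter.mp hv).2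
        _ ≤ #W + #U := card_union_le _ _
        _ ≤ 2 * 2 ^ K + K := by omega
    have := Nat.mul_le_mul_left K h2
    omega
  have hin : ∑ v ∈ T, #(U ∩ G.neighborFinset v) ≤
      #𝒞 * (3 * K + 495) + 6 * K * (2 * 2 ^ K) := by
    rw [hTdef, sum_biUnion hd]
    have h1 : ∀ C ∈ 𝒞, ∑ v ∈ id C, #(U ∩ G.neighborFinset v) ≤
        (3 * K + 495) + if C ∈ ℋ then 6 * K else 0 := by
      intro C hC
      have hC6 := (h𝒞 C hC).card
      split_ifs with hCℋ
      · have := sum_le_card_nsmul C _ K fun v _ => hle v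
        rw [hC6, smul_eq_mul] at this
        simp only [id]
        omega
      · rw [hℋ, mem_filter] at hCℋ
        push Not at hCℋ
        rw [← hU]
        exact sum_card_inter_neighborFinset_le hC6 fun S hS hS4 =>
          Nat.le_of_lt_succ (hCℋ hC S hS hS4)
    refine (sum_le_sum h1).trans ?_
    rw [sum_add_distrib, ← sum_filter, sum_const, sum_const, smul_eq_mul, smul_eq_mul]
    have h2 : #{C ∈ 𝒞 | C ∈ ℋ} ≤ 2 * 2 ^ K :=
      (card_le_card fun C hC => (mem_filter.mp hC).2).trans hℋcard
    have := Nat.mul_le_mul_left (6 * K) h2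
    rw [mul_comm _ (6 * K)]
    omega
  have hlow : (K : ℝ) * ((1 / 2 + η / 2) * Fintype.card V) ≤
      ∑ u ∈ U, (#(R ∩ G.neighborFinset u) : ℝ) := by
    have := card_nsmul_le_sum U (fun u => (#(R ∩ G.neighborFinset u) : ℝ)) _ fun u _ => hR u
    rwa [hU, nsmul_eq_mul] at this
  have hsum : ∑ u ∈ U, #(R ∩ G.neighborFinset u) ≤
      (2 * #(R \ T) + K * (2 * 2 ^ K + K)) + (#𝒞 * (3 * K + 495) + 6 * K * (2 * 2 ^ K)) := by
    rw [sum_card_inter_neighborFinset_comm, ← sum_sdiff hTR]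
    exact add_le_add hout hin
  have hsumR : ∑ u ∈ U, (#(R ∩ G.neighborFinset u) : ℝ) ≤
      (2 * #(R \ T) + K * (2 * 2 ^ K + K)) + (#𝒞 * (3 * K + 495) + 6 * K * (2 * 2 ^ K)) := by
    exact_mod_cast hsum
  have hnR : (K * (14 * 2 ^ K + K) : ℝ) < Fintype.card V := by exact_mod_cast hn
  have hT6 : #T = 6 * #𝒞 := card_biUnion_of_isHexagon h𝒞 hd
  have htot : (#(R \ T) + 6 * #𝒞 : ℝ) ≤ Fintype.card V := by
    have h1 := card_sdiff_add_card_eq_card hTR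
    have h2 := card_le_univ R
    exact_mod_cast (by omega : #(R \ T) + 6 * #𝒞 ≤ Fintype.card V)
  have hr0 : (0 : ℝ) ≤ #(R \ T) := by positivity
  have hc0 : (0 : ℝ) ≤ #𝒞 := by positivity
  have hK6' : (6 : ℝ) ≤ K := by exact_mod_cast hK6
  have hn0 : (0 : ℝ) ≤ Fintype.card V := by positivity
  have h1 := mul_le_mul_of_nonneg_right hK hn0
  have h2 := mul_le_mul_of_nonneg_left htot (by positivity : (0 : ℝ) ≤ K / 2 + 85)
  nlinarith [mul_nonneg hr0 (by linarith : (0 : ℝ) ≤ K)]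

end AlmostTiling

open Filter in
/-- An auxiliary parameter that grows with `n`, but slowly enough. -/
theorem exists_nat_pow_mul_lt_and_mul_add_lt {c C D : ℝ} (hc : 0 < c) :
    ∃ n₀ : ℕ, ∀ n ≥ n₀, ∃ k : ℕ, 3 ^ k * n < 4 ^ k ∧ C * k + D < c * n := by
  have h1 : ∀ᶠ k : ℕ in atTop, (k + 1 : ℝ) ^ 2 * (3 / 4 : ℝ) ^ k < 1 := by
    have h2 := tendsto_pow_const_mul_const_pow_of_abs_lt_one 2
      (show |(3 / 4 : ℝ)| < 1 by norm_num [abs_of_pos])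
    have h3 := (h2.comp (tendsto_add_atTop_nat 1)).eventually_lt_const
      (show (0 : ℝ) < 3 / 4 by norm_num)
    filter_upwards [h3] with k hk
    simp only [Function.comp_apply, pow_succ _ k] at hk
    push_cast at hk
    linarith
  have h4 : ∀ᶠ k : ℕ in atTop, C * k + D < c * (k : ℝ) ^ 2 := by
    have h5 : Tendsto (fun x : ℝ => x * (c * x - C)) atTop atTop :=
      tendsto_id.atTop_mul_atTop₀
        (tendsto_atTop_add_const_right _ (-C) (tendsto_id.const_mul_atTop hc))
    filter_upwards [(h5.comp tendsto_natCast_atTop_atTop).eventually_gt_atTop D] with k hk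
    simp only [Function.comp_apply] at hk
    linarith
  have hsqrt : Tendsto Nat.sqrt atTop atTop :=
    tendsto_atTop_mono' _ (Eventually.of_forall fun n => le_rfl)
      (tendsto_atTop_atTop.mpr fun b => ⟨b * b, fun a ha => Nat.le_sqrt.mpr ha⟩)
  obtain ⟨n₀, hn₀⟩ := eventually_atTop.mp (hsqrt.eventually (h1.and h4))
  refine ⟨n₀, fun n hn => ⟨n.sqrt, ?_, ?_⟩⟩
  · have h6 := (hn₀ n hn).1
    have h7 : (n : ℝ) < (n.sqrt + 1) ^ 2 := by exact_mod_cast Nat.lt_succ_sqrt' n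
    rw [div_pow, ← mul_div_assoc, div_lt_one (by positivity)] at h6
    have h8 : (3 : ℝ) ^ n.sqrt * n < 4 ^ n.sqrt := by
      refine lt_trans ?_ h6
      rw [mul_comm]
      gcongr
    exact_mod_cast h8
  · have h7 : ((n.sqrt : ℝ)) ^ 2 ≤ n := by exact_mod_cast Nat.sqrt_le' n
    exact (hn₀ n hn).2.trans_le (by gcongr)

/-- Every sufficiently large graph `G` on `n` vertices with `6 ∣ n` and
`δ(G) ≥ (1/2 + η)n` contains a perfect `C₆`-packing. -/
theorem perfect_C6_packing (η : ℝ) (hη0 : 0 < η) (hη1 : η < 1 / 2) :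
    ∃ n₀ : ℕ, ∀ (V : Type) [Fintype V] (G : SimpleGraph V),
      n₀ ≤ Fintype.card V →
      6 ∣ Fintype.card V →
      (1 / 2 + η) * (Fintype.card V : ℝ) ≤ (G.minDegree : ℝ) →
      HasPerfectC6Packing G := by
  obtain ⟨K, hK⟩ := exists_nat_ge (max (400 / η) 6)
  have hK400 : 400 ≤ K * η := (div_le_iff₀ hη0).mp ((le_max_left _ _).trans hK)
  have hK6 : 6 ≤ K := by exact_mod_cast (le_max_right _ _).trans hK
  obtain ⟨n₁, hn₁⟩ := exists_nat_pow_mul_lt_and_mul_add_lt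
    (c := η / 2) (C := 12 * (K + 1)) (D := 30 * (K + 1) + K) (half_pos hη0)
  refine ⟨max n₁ (K * (14 * 2 ^ K + K) + 1), fun V _ G hn h6 hδ => ?_⟩
  obtain ⟨k, hk, hkn⟩ := hn₁ (Fintype.card V) ((le_max_left _ _).trans hn)
  have hK0 : (0 : ℝ) ≤ K := by positivity
  have hk0 : (0 : ℝ) ≤ k := by positivity
  have hG : ∀ v, (1 / 2 + η) * Fintype.card V ≤ #(G.neighborFinset v) := fun v =>
    hδ.trans (by exact_mod_cast G.minDegree_le_degree v)
  obtain ⟨A, hA, hAU⟩ := exists_absorbing_set hη1 hG hk K (by nlinarith)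
  have hA' : (#A : ℝ) = K * (12 * k + 5) := by exact_mod_cast hA
  have hAη : (#A + K : ℝ) ≤ η / 2 * Fintype.card V := by rw [hA']; nlinarith
  have hR : ∀ v, (1 / 2 + η / 2) * Fintype.card V ≤ #(Aᶜ ∩ G.neighborFinset v) := by
    intro v
    have h1 : #(G.neighborFinset v) ≤ #(Aᶜ ∩ G.neighborFinset v) + #A := by
      rw [inter_comm, ← sdiff_eq_inter_compl]
      exact card_le_card_sdiff_add_card
    have h2 : (#(G.neighborFinset v) : ℝ) ≤ #(Aᶜ ∩ G.neighborFinset v) + #A := by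
      exact_mod_cast h1
    linarith [hG v]
  obtain ⟨T, hTA, hT, hTK⟩ := exists_tileable_card_sdiff_lt hK400 hK6 hR
    (lt_of_lt_of_le (Nat.lt_succ_self _) ((le_max_right _ _).trans hn))
  have hcard : #A + #Aᶜ = Fintype.card V := card_add_card_compl A
  have hTc := card_sdiff_add_card_eq_card hTA
  have hKA : K ≤ #Aᶜ := by
    have h1 : (#A + K : ℝ) ≤ Fintype.card V := by nlinarith
    have h2 : #A + K ≤ Fintype.card V := by exact_mod_cast h1
    omega
  have hKA6 : 6 ∣ K + #A := by
    obtain ⟨U, hU, hUK⟩ := exists_subset_card_eq hKA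
    have hUA : Disjoint U A := disjoint_of_subset_left hU disjoint_compl_left
    have := (hAU U hUA hUK).six_dvd_card
    rwa [card_union_of_disjoint hUA, hUK] at this
  obtain ⟨j, hj⟩ : 6 ∣ #Aᶜ - K := by omega
  obtain ⟨T', hT'T, hT', hT'j⟩ := hT.exists_subset_card_eq (j := j) (by omega)
  have hU : IsTileable G (Aᶜ \ T' ∪ A) := by
    refine hAU _ (disjoint_of_subset_left sdiff_subset disjoint_compl_left) ?_
    rw [card_sdiff_of_subset (hT'T.trans hTA)]
    omega
  refine IsTileable.hasPerfectC6Packing ?_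
  convert hU.union hT' ?_ using 1
  · ext x
    simp only [mem_univ, mem_union, mem_sdiff, mem_compl, true_iff]
    tauto
  · rw [disjoint_union_left]
    exact ⟨sdiff_disjoint, disjoint_of_subset_right (hT'T.trans hTA) disjoint_compl_right⟩
end

section
/- Chvátal's Theorem: Let G be a graph on n ≥ 3 vertices with degree sequence d₁ ≤ d₂ ≤ ⋯ ≤ d_n. If for every integer i with 1 ≤ i < n/2 one has d_i ≥ i + 1 or d_{n−i} ≥ n − i, then G contains a Hamilton cycle. -/
open Finset
open scoped Classical

namespace SimpleGraph

variable {V : Type*} [Fintype V] {G H : SimpleGraph V} {u v : V}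

/-- A Hamiltonian path whose ends are adjacent closes up to a Hamiltonian cycle. -/
lemma Walk.IsHamiltonian.isHamiltonian_of_adj {p : G.Walk u v} (hp : p.IsHamiltonian)
    (huv : G.Adj v u) (hV : 3 ≤ Fintype.card V) : G.IsHamiltonian := by
  intro _
  have hlen := hp.length_eq
  refine ⟨v, .cons huv p, ?_⟩
  rw [Walk.isHamiltonianCycle_iff_isCycle_and_length_eq,
    Walk.isCycle_iff_isPath_tail_and_le_length]
  refine ⟨⟨by simpa using hp.isPath, ?_⟩, ?_⟩ <;> rw [Walk.length_cons] <;> omega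

lemma isHamiltonian_of_forall_adj (hV : 3 ≤ Fintype.card V)
    (h : ∀ a b, a ≠ b → G.Adj a b) : G.IsHamiltonian := by
  have hchain : (univ : Finset V).toList.IsChain G.Adj :=
    ((univ : Finset V).nodup_toList.imp fun {a b} => h a b).isChain
  have hlen : (univ : Finset V).toList.length = Fintype.card V := by simp
  have hne : (univ : Finset V).toList ≠ [] := by
    intro h0
    rw [h0, List.length_nil] at hlen
    omega
  have hp : (Walk.ofSupport _ hne hchain).IsPath := by
    rw [Walk.isPath_def, Walk.support_ofSupport]
    exact nodup_toList _
  have hpl := Walk.length_ofSupport hne hchain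
  have hham : (Walk.ofSupport _ hne hchain).IsHamiltonian :=
    Walk.isHamiltonian_iff_isPath_and_length_eq.2 ⟨hp, by rw [hpl, hlen]⟩
  refine hham.isHamiltonian_of_adj (h _ _ fun heq => ?_) hV
  have h0 := (hp.getVert_eq_end_iff (i := 0) (Nat.zero_le _)).1 (by rw [Walk.getVert_zero, heq])
  omega

/-- Rotating a Hamiltonian path: a pair of crossing chords from its ends yields a Hamiltonian
cycle. -/
lemma Walk.IsHamiltonian.isHamiltonian_of_crossing {p : G.Walk u v} (hp : p.IsHamiltonian)
    {i : ℕ} (hi : i < p.length) (hv : G.Adj (p.getVert i) v) (hu : G.Adj (p.getVert (i + 1)) u)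
    (hV : 3 ≤ Fintype.card V) : G.IsHamiltonian := by
  have hq : ((p.take i).append (.cons hv (p.drop (i + 1)).reverse)).IsHamiltonian := by
    have hlen := hp.length_eq
    refine Walk.isHamiltonian_iff_isPath_and_length_eq.2 ⟨?_, ?_⟩
    · rw [Walk.isPath_def, Walk.support_append, Walk.support_cons, List.tail_cons,
        Walk.support_reverse, Walk.support_take, Walk.drop_support_eq_support_drop_min,
        Nat.min_eq_left (by omega)]
      refine (List.Perm.nodup_iff ?_).2 hp.isPath.support_nodup
      exact ((List.reverse_perm _).append_left _).trans (by rw [List.take_append_drop])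
    · rw [Walk.length_append, Walk.length_cons, Walk.length_reverse, Walk.take_length,
        Walk.drop_length]
      omega
  exact hq.isHamiltonian_of_adj hu hV

/-- The degree count behind Ore's theorem. -/
lemma Walk.IsHamiltonian.degree_add_degree_lt {p : G.Walk u v} (hp : p.IsHamiltonian)
    (hG : ¬ G.IsHamiltonian) (hV : 3 ≤ Fintype.card V) :
    G.degree u + G.degree v < Fintype.card V := by
  have hlen := hp.length_eq
  set A := {i ∈ range p.length | G.Adj (p.getVert i) v} with hA
  set B := {i ∈ range p.length | G.Adj (p.getVert (i + 1)) u} with hB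
  have hAB : Disjoint A B := by
    rw [Finset.disjoint_left]
    intro i hiA hiB
    rw [hA, mem_filter, mem_range] at hiA
    rw [hB, mem_filter] at hiB
    exact hG (hp.isHamiltonian_of_crossing hiA.1 hiA.2 hiB.2 hV)
  have hcA : G.degree v ≤ #A := by
    rw [← card_neighborFinset_eq_degree]
    refine (card_le_card (t := A.image p.getVert) fun w hw => ?_).trans card_image_le
    rw [mem_neighborFinset] at hw
    obtain ⟨i, rfl, hi⟩ := Walk.mem_support_iff_exists_getVert.1 (hp.mem_support w)
    refine mem_image_of_mem _ (mem_filter.2 ⟨mem_range.2 (hi.lt_of_ne ?_), hw.symm⟩)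
    rintro rfl
    exact hw.ne (by simp)
  have hcB : G.degree u ≤ #B := by
    rw [← card_neighborFinset_eq_degree]
    refine (card_le_card (t := B.image fun i => p.getVert (i + 1)) fun w hw => ?_).trans
      card_image_le
    rw [mem_neighborFinset] at hw
    obtain ⟨i, rfl, hi⟩ := Walk.mem_support_iff_exists_getVert.1 (hp.mem_support w)
    cases i with
    | zero => exact absurd rfl (hw.ne.trans_eq (by simp))
    | succ i => exact mem_image.2 ⟨i, mem_filter.2 ⟨mem_range.2 hi, hw.symm⟩, rfl⟩
  have hsub : #(A ∪ B) ≤ #(range p.length) :=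
    card_le_card (union_subset (filter_subset _ _) (filter_subset _ _))
  rw [card_union_of_disjoint hAB, card_range] at hsub
  omega

/-- If adding the edge `uv` makes a graph Hamiltonian, then the graph is Hamiltonian already or
has a Hamiltonian path between `u` and `v`. -/
lemma IsHamiltonian.exists_isHamiltonian_walk (h : (G ⊔ edge u v).IsHamiltonian)
    (hG : ¬ G.IsHamiltonian) (hV : 3 ≤ Fintype.card V) :
    ∃ p : G.Walk v u, p.IsHamiltonian := by
  have : Nontrivial V := Fintype.one_lt_card_iff_nontrivial.1 (by omega)
  obtain ⟨c, hc⟩ := h.exists_isHamiltonianCycle u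
  have hadj : ∀ {a b}, (G ⊔ edge u v).Adj a b → s(a, b) ≠ s(u, v) → G.Adj a b := by
    intro a b hab hne
    rcases hab with hab | hab
    · exact hab
    · exact absurd ((adj_edge _ _).1 hab).1.symm hne
  have hmem : s(u, v) ∈ c.edges := by
    by_contra hmem
    have hsub : ∀ e ∈ c.edges, e ∈ G.edgeSet := by
      intro e he
      induction e with | _ a b
      exact hadj (c.adj_of_mem_edges he) fun heq => hmem (heq ▸ he)
    refine hG fun _ => ⟨u, c.transfer G hsub, ?_⟩
    rw [Walk.isHamiltonianCycle_iff_isCycle_and_length_eq]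
    exact ⟨hc.isCycle.transfer hsub, by rw [Walk.length_transfer, hc.length_eq]⟩
  obtain ⟨c, hc, hsnd⟩ : ∃ c : (G ⊔ edge u v).Walk u u, c.IsHamiltonianCycle ∧ c.snd = v := by
    have hv : v ∈ c.toSubgraph.neighborSet u := by
      rwa [Subgraph.mem_neighborSet, Walk.adj_toSubgraph_iff_mem_edges]
    rw [hc.isCycle.neighborSet_toSubgraph_endpoint] at hv
    rcases hv with hv | hv
    · exact ⟨c, hc, hv.symm⟩
    · refine ⟨c.reverse, ?_, by rw [Walk.snd_reverse]; exact hv.symm⟩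
      rw [Walk.isHamiltonianCycle_iff_isCycle_and_length_eq]
      exact ⟨hc.isCycle.reverse, by rw [Walk.length_reverse, hc.length_eq]⟩
  cases c with
  | nil => exact absurd rfl hc.isCycle.ne_nil
  | @cons _ w _ huw q =>
    obtain rfl : w = v := by simpa using hsnd
    obtain ⟨hq, hnot⟩ := (Walk.cons_isCycle_iff _ _).1 hc.isCycle
    have hsub : ∀ e ∈ q.edges, e ∈ G.edgeSet := by
      intro e he
      induction e with | _ a b
      exact hadj (q.adj_of_mem_edges he) fun heq => hnot (heq ▸ he)
    have hlen := hc.length_eq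
    rw [Walk.length_cons] at hlen
    refine ⟨q.transfer G hsub, Walk.isHamiltonian_iff_isPath_and_length_eq.2
      ⟨hq.transfer hsub, ?_⟩⟩
    rw [Walk.length_transfer]
    omega

lemma card_filter_ne_and_not_adj_add_degree (G : SimpleGraph V) (u : V) :
    #{w | w ≠ u ∧ ¬ G.Adj u w} + G.degree u + 1 = Fintype.card V := by
  have h1 := card_filter_add_card_filter_not (s := (univ.erase u : Finset V)) (G.Adj u)
  have h2 : {w ∈ univ.erase u | G.Adj u w} = G.neighborFinset u := by
    ext w
    simp only [mem_filter, mem_erase, mem_univ, and_true, mem_neighborFinset]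
    exact ⟨fun h => h.2, fun h => ⟨h.ne', h⟩⟩
  have h3 : {w ∈ univ.erase u | ¬ G.Adj u w} =
      ({w | w ≠ u ∧ ¬ G.Adj u w} : Finset V) := by
    ext w
    simp
  have h4 := card_erase_add_one (mem_univ u)
  rw [h2, h3, card_neighborFinset_eq_degree] at h1
  rw [card_univ] at h4
  omega

/-- In an edge-maximal non-Hamiltonian graph, many vertices have small degree. -/
lemma exists_le_card_filter_degree_le (hV : 3 ≤ Fintype.card V)
    (hG : Maximal (fun H : SimpleGraph V => ¬ H.IsHamiltonian) G) :
    ∃ k, 1 ≤ k ∧ 2 * k < Fintype.card V ∧ k ≤ #{w | G.degree w ≤ k} ∧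
      Fintype.card V - k ≤ #{w | G.degree w ≤ Fintype.card V - k - 1} := by
  have hne : ({z : V × V | z.1 ≠ z.2 ∧ ¬ G.Adj z.1 z.2} : Finset (V × V)).Nonempty := by
    by_contra hempty
    refine hG.prop (isHamiltonian_of_forall_adj hV fun a b hab => ?_)
    by_contra hn
    exact hempty ⟨(a, b), by simp [hab, hn]⟩
  obtain ⟨⟨x, y⟩, hxy, hmax⟩ :=
    exists_max_image _ (fun z : V × V => G.degree z.1 + G.degree z.2) hne
  simp only [mem_filter, mem_univ, true_and, Prod.forall, and_imp] at hxy hmax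
  obtain ⟨hxy, hnadj⟩ := hxy
  wlog hle : G.degree x ≤ G.degree y generalizing x y
  · refine this y x (fun a b hab hn => ?_) hxy.symm (fun h => hnadj h.symm) (by omega)
    have := hmax a b hab hn
    omega
  have hham : (G ⊔ edge x y).IsHamiltonian := by
    by_contra hn
    have hle' := hG.le_of_ge hn le_sup_left
    exact hnadj (hle' (Or.inr ((adj_edge _ _).2 ⟨rfl, hxy⟩)))
  obtain ⟨p, hp⟩ := hham.exists_isHamiltonian_walk hG.prop hV
  have hlt := hp.degree_add_degree_lt hG.prop hV
  have hcx := G.card_filter_ne_and_not_adj_add_degree x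
  have hcy := G.card_filter_ne_and_not_adj_add_degree y
  have hy : ∀ w, w ≠ y → ¬ G.Adj y w → G.degree w ≤ G.degree x := by
    intro w hw hn
    have := hmax w y hw fun h => hn h.symm
    omega
  have hx : ∀ w, w ≠ x → ¬ G.Adj x w → G.degree w ≤ G.degree y := by
    intro w hw hn
    have := hmax x w hw.symm hn
    omega
  have hsmall : G.degree x ≤ #{w | G.degree w ≤ G.degree x} := by
    have : #{w | w ≠ y ∧ ¬ G.Adj y w} ≤ #{w | G.degree w ≤ G.degree x} :=
      card_le_card fun w hw => by
        rw [mem_filter] at hw ⊢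
        exact ⟨hw.1, hy w hw.2.1 hw.2.2⟩
    omega
  have hlarge : Fintype.card V - G.degree x ≤ #{w | G.degree w ≤ G.degree y} := by
    have hsub : insert x ({w | w ≠ x ∧ ¬ G.Adj x w} : Finset V) ⊆
        ({w | G.degree w ≤ G.degree y} : Finset V) := by
      intro w hw
      rw [mem_insert, mem_filter] at hw
      rw [mem_filter]
      rcases hw with rfl | hw
      · exact ⟨mem_univ _, hle⟩
      · exact ⟨mem_univ _, hx w hw.2.1 hw.2.2⟩
    have := card_le_card hsub
    rw [card_insert_of_notMem (by simp)] at this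
    omega
  have hmono : ∀ {a b : ℕ}, a ≤ b → #{w | G.degree w ≤ a} ≤ #{w | G.degree w ≤ b} :=
    fun hab => card_le_card (monotone_filter_right _ fun _ _ h => le_trans h hab)
  rcases Nat.eq_zero_or_pos (G.degree x) with h0 | hpos
  · refine ⟨1, le_rfl, by omega, ?_, ?_⟩
    · exact card_pos.2 ⟨x, by simp [h0]⟩
    · have hpos : 0 < #{w | w ≠ y ∧ ¬ G.Adj y w} :=
        card_pos.2 ⟨x, by simpa [hxy] using fun h => hnadj h.symm⟩
      have := hmono (show G.degree y ≤ Fintype.card V - 1 - 1 by omega)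
      omega
  · refine ⟨G.degree x, hpos, by omega, hsmall, ?_⟩
    have := hmono (show G.degree y ≤ Fintype.card V - G.degree x - 1 by omega)
    omega

end SimpleGraph

lemma le_of_lt_card_filter_le {V : Type*} [Fintype V] {n : ℕ} (e : Fin n ≃ V) {f : V → ℕ}
    (hf : Monotone fun i => f (e i)) {i : Fin n} {m : ℕ} (hi : (i : ℕ) < #{v | f v ≤ m}) :
    f (e i) ≤ m := by
  by_contra! hlt
  have hsub : ({v | f v ≤ m} : Finset V) ⊆ (Iio i).image e := by
    intro v hv
    rw [mem_filter] at hv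
    refine mem_image.2 ⟨e.symm v, mem_Iio.2 ?_, e.apply_symm_apply v⟩
    by_contra! hle
    have := hf hle
    simp only [Equiv.apply_symm_apply] at this
    omega
  have := (card_le_card hsub).trans card_image_le
  rw [Fin.card_Iio] at this
  omega

/-- **Chvátal's Theorem.** Let `G` be a graph on `n ≥ 3` vertices with degree sequence
`d₁ ≤ d₂ ≤ ⋯ ≤ d_n` (here `d_{i+1} = deg (e i)` for a monotone enumeration `e` of the
vertices). If for every `1 ≤ i < n/2` we have `d_i ≥ i + 1` or `d_{n−i} ≥ n − i`, then
`G` has a Hamilton cycle. -/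
theorem chvatal_theorem {V : Type} [Fintype V] (G : SimpleGraph V) (n : ℕ)
    (hcard : Fintype.card V = n) (hn : 3 ≤ n)
    (e : Fin n ≃ V)
    (hmono : Monotone fun i : Fin n => G.degree (e i))
    (hcond : ∀ i : Fin n, 2 * ((i : ℕ) + 1) < n →
      ((i : ℕ) + 2 ≤ G.degree (e i) ∨
        ∀ j : Fin n, (j : ℕ) + 1 = n - ((i : ℕ) + 1) →
          n - ((i : ℕ) + 1) ≤ G.degree (e j))) :
    G.IsHamiltonian := by
  by_contra hG
  obtain ⟨H, hGH, hH⟩ :=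
    (Set.toFinite {H : SimpleGraph V | ¬ H.IsHamiltonian}).exists_le_maximal hG
  obtain ⟨k, hk, hkn, hsmall, hlarge⟩ :=
    SimpleGraph.exists_le_card_filter_degree_le (by omega) hH
  rw [hcard] at hkn hlarge
  have hmem : ∀ m, #{w | H.degree w ≤ m} ≤ #{w | G.degree w ≤ m} := fun m =>
    card_le_card (monotone_filter_right _ fun _ _ h => (SimpleGraph.degree_le_of_le hGH).trans h)
  have hs := hmem k
  have hl := hmem (n - k - 1)
  rcases hcond ⟨k - 1, by omega⟩ (by simp only; omega) with h | h
  · have := le_of_lt_card_filter_le e (f := fun v => G.degree v) hmono (i := ⟨k - 1, by omega⟩) (m := k)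
      (by simp only; omega)
    simp only at h
    omega
  · have h := h ⟨n - k - 1, by omega⟩ (by simp only; omega)
    have := le_of_lt_card_filter_le e (f := fun v => G.degree v) hmono (i := ⟨n - k - 1, by omega⟩) (m := n - k - 1)
      (by simp only; omega)
    simp only at h
    omega
end

section
/- Let 0 < ν ≤ τ ≤ 1/2 and suppose G is a robust (ν, τ)-outexpander on n vertices. Let V₀ ⊆ V(G) be any set of at most νn/4 vertices. Then the digraph G' = G ∖ V₀ obtained by deleting V₀ (together with all edges incident to V₀) is a robust (ν/2, 2τ)-outexpander. -/
open Finset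
open scoped Classical

/-- The out-degree of a vertex in a digraph given by its edge relation. -/
noncomputable def outDeg {V : Type*} [Fintype V] (G : V → V → Prop) (x : V) : ℕ :=
  (Finset.univ.filter fun y => G x y).card

/-- The in-degree of a vertex in a digraph given by its edge relation. -/
noncomputable def inDeg {V : Type*} [Fintype V] (G : V → V → Prop) (x : V) : ℕ :=
  (Finset.univ.filter fun y => G y x).card

/-- The `ν`-robust outneighbourhood of `S`: all vertices with at least `νn`
in-neighbours in `S`. -/
noncomputable def robustOutNbhd {V : Type*} [Fintype V] (G : V → V → Prop) (ν : ℝ)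
    (S : Finset V) : Finset V :=
  Finset.univ.filter fun v => ν * (Fintype.card V : ℝ) ≤ ((S.filter fun s => G s v).card : ℝ)

/-- The `ν`-robust inneighbourhood of `S`: all vertices with at least `νn`
out-neighbours in `S`. -/
noncomputable def robustInNbhd {V : Type*} [Fintype V] (G : V → V → Prop) (ν : ℝ)
    (S : Finset V) : Finset V :=
  Finset.univ.filter fun v => ν * (Fintype.card V : ℝ) ≤ ((S.filter fun s => G v s).card : ℝ)

/-- `G` is a robust `(ν,τ)`-outexpander. -/
def RobustOutexpander {V : Type*} [Fintype V] (G : V → V → Prop) (ν τ : ℝ) : Prop :=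
  ∀ S : Finset V, τ * (Fintype.card V : ℝ) < (S.card : ℝ) →
    (S.card : ℝ) < (1 - τ) * (Fintype.card V : ℝ) →
    (S.card : ℝ) + ν * (Fintype.card V : ℝ) ≤ ((robustOutNbhd G ν S).card : ℝ)

/-- `G` is a robust `(ν,τ)`-inexpander. -/
def RobustInexpander {V : Type*} [Fintype V] (G : V → V → Prop) (ν τ : ℝ) : Prop :=
  ∀ S : Finset V, τ * (Fintype.card V : ℝ) < (S.card : ℝ) →
    (S.card : ℝ) < (1 - τ) * (Fintype.card V : ℝ) →
    (S.card : ℝ) + ν * (Fintype.card V : ℝ) ≤ ((robustInNbhd G ν S).card : ℝ)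

/-- A directed Hamilton cycle in the digraph `G`: a cyclic ordering of all the
vertices such that consecutive vertices are joined by a directed edge. -/
def HasDiHamCycle {V : Type*} [Fintype V] (G : V → V → Prop) : Prop :=
  ∃ e : ZMod (Fintype.card V) ≃ V, ∀ i, G (e i) (e (i + 1))

/-- Deleting at most `νn/4` vertices from a robust `(ν,τ)`-outexpander leaves a
robust `(ν/2, 2τ)`-outexpander (with respect to its own number of vertices). -/
theorem robust_outexpander_delete_vertices {V : Type} [Fintype V]
    (G : V → V → Prop) (hirr : ∀ v : V, ¬ G v v) (ν τ : ℝ)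
    (hν : 0 < ν) (hντ : ν ≤ τ) (hτ : τ ≤ 1 / 2)
    (hG : RobustOutexpander G ν τ)
    (V₀ : Finset V) (hV₀ : (V₀.card : ℝ) ≤ ν * (Fintype.card V : ℝ) / 4) :
    RobustOutexpander (fun a b : {v : V // v ∉ V₀} => G a.1 b.1) (ν / 2) (2 * τ) := by
  intro S hS₁ hS₂
  have hn : (Fintype.card {v : V // v ∉ V₀} : ℝ) = Fintype.card V - V₀.card := by
    have h : Fintype.card {v : V // v ∉ V₀} + V₀.card = Fintype.card V := by
      rw [Fintype.card_subtype_compl, Fintype.card_coe]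
      exact Nat.sub_add_cancel V₀.card_le_univ
    rw [← h]
    push_cast
    ring
  have hm : (0 : ℝ) ≤ V₀.card := Nat.cast_nonneg _
  have hN : (0 : ℝ) ≤ Fintype.card V := Nat.cast_nonneg _
  rw [hn] at hS₁ hS₂ ⊢
  set T : Finset V := S.map (Function.Embedding.subtype _) with hT
  have hTS : T.card = S.card := card_map _
  have hexp := hG T
    (by rw [hTS]; nlinarith [mul_nonneg (hν.le.trans hντ) hN])
    (by rw [hTS]; nlinarith [mul_nonneg (hν.le.trans hντ) hN])
  rw [hTS] at hexp
  have hsub : robustOutNbhd G ν T ⊆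
      (robustOutNbhd (fun a b : {v : V // v ∉ V₀} => G a.1 b.1) (ν / 2) S).map
        (Function.Embedding.subtype _) ∪ V₀ := by
    intro v hv
    by_cases hv₀ : v ∈ V₀
    · exact mem_union_right _ hv₀
    refine mem_union_left _ (mem_map.2 ⟨⟨v, hv₀⟩, ?_, rfl⟩)
    simp only [robustOutNbhd, mem_filter, mem_univ, true_and] at hv ⊢
    rw [hT, filter_map, card_map] at hv
    rw [hn]
    refine le_trans ?_ hv
    nlinarith [mul_nonneg hν.le hN, mul_nonneg hν.le hm]
  have hcard := (card_le_card hsub).trans (card_union_le _ _)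
  rw [card_map] at hcard
  have hcard' : ((robustOutNbhd G ν T).card : ℝ) ≤
      ((robustOutNbhd (fun a b : {v : V // v ∉ V₀} => G a.1 b.1) (ν / 2) S).card : ℝ)
        + V₀.card := by exact_mod_cast hcard
  nlinarith [mul_nonneg hν.le hN, mul_nonneg hν.le hm]
end

section
/- For every η ∈ (0,1) there exists τ₀ > 0 such that for every τ ∈ (0, τ₀] and every ν ∈ (0, τ] there exists an integer n₀ so that the following holds. If G is a digraph on n ≥ n₀ vertices with δ⁰(G) ≥ ηn and G is a robust (ν, τ)-outexpander, then G is also a robust (ν³, 2τ)-inexpander. -/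
open Finset
open scoped Classical

/-- If every vertex of `T` has at most `a` out-neighbours in `S`, then double counting the edges
from `T` to the `ν`-robust outneighbourhood of `T` inside `S` bounds the latter. -/
theorem mul_card_robustOutNbhd_inter_le {V : Type*} [Fintype V] (G : V → V → Prop) (ν a : ℝ)
    (S T : Finset V) (hT : ∀ t ∈ T, ((S.filter fun s => G t s).card : ℝ) ≤ a) :
    ((robustOutNbhd G ν T ∩ S).card : ℝ) * (ν * (Fintype.card V : ℝ)) ≤ (T.card : ℝ) * a := by
  have hcount := Finset.sum_card_bipartiteAbove_eq_sum_card_bipartiteBelow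
    (s := T) (t := robustOutNbhd G ν T ∩ S) G
  have hlower : ((robustOutNbhd G ν T ∩ S).card : ℝ) * (ν * (Fintype.card V : ℝ)) ≤
      ∑ v ∈ robustOutNbhd G ν T ∩ S, ((Finset.bipartiteBelow G T v).card : ℝ) := by
    rw [← nsmul_eq_mul]
    refine Finset.card_nsmul_le_sum _ _ _ fun v hv => ?_
    exact (Finset.mem_filter.mp (Finset.mem_inter.mp hv).1).2
  have hupper : ∑ t ∈ T,
      ((Finset.bipartiteAbove G (robustOutNbhd G ν T ∩ S) t).card : ℝ) ≤ (T.card : ℝ) * a := by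
    rw [← nsmul_eq_mul]
    refine Finset.sum_le_card_nsmul _ _ _ fun t ht => le_trans ?_ (hT t ht)
    exact_mod_cast Finset.card_le_card (Finset.filter_subset_filter _ Finset.inter_subset_right)
  have hcount' : ∑ t ∈ T, ((Finset.bipartiteAbove G (robustOutNbhd G ν T ∩ S) t).card : ℝ) =
      ∑ v ∈ robustOutNbhd G ν T ∩ S, ((Finset.bipartiteBelow G T v).card : ℝ) := by
    exact_mod_cast hcount
  linarith

/-- Robust outexpansion implies robust inexpansion, without any degree condition. -/
theorem RobustOutexpander.robustInexpander {V : Type*} [Fintype V] {G : V → V → Prop} {ν τ : ℝ}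
    (hν : 0 < ν) (hντ : ν ≤ τ) (hτ : τ ≤ 1 / 2) (hG : RobustOutexpander G ν τ) :
    RobustInexpander G (ν ^ 3) (2 * τ) := by
  intro S hS₁ hS₂
  by_contra! hB
  set n : ℝ := (Fintype.card V : ℝ)
  have hn0 : 0 < n := by
    have : (0 : ℝ) ≤ n := Nat.cast_nonneg _
    rcases this.eq_or_lt with h | h
    · rw [← h] at hS₁ hS₂
      linarith
    · exact h
  have hν2 : ν ^ 2 ≤ 1 / 4 := by nlinarith
  have hν3 : ν ^ 3 ≤ ν / 4 := by nlinarith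
  have hν3n : ν ^ 3 * n ≤ ν / 4 * n := by gcongr
  have hντn : ν * n ≤ τ * n := by gcongr
  have hνn : 0 < ν * n := by positivity
  have hBc : ((robustInNbhd G (ν ^ 3) S)ᶜ.card : ℝ) = n - (robustInNbhd G (ν ^ 3) S).card := by
    rw [Finset.card_compl, Nat.cast_sub (Finset.card_le_univ _)]
  have hSc : (Sᶜ.card : ℝ) = n - S.card := by
    rw [Finset.card_compl, Nat.cast_sub (Finset.card_le_univ _)]
  obtain ⟨T, hTB, hTcard⟩ := Finset.exists_subset_card_eq
    (min_le_left (robustInNbhd G (ν ^ 3) S)ᶜ.card Sᶜ.card)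
  have hT₁ : n - S.card - ν ^ 3 * n ≤ T.card := by
    rw [hTcard, Nat.cast_min, le_min_iff, hBc, hSc]
    constructor
    · linarith
    · have : 0 < ν ^ 3 * n := by positivity
      linarith
  have hT₂ : (T.card : ℝ) ≤ n - S.card := by
    rw [hTcard, ← hSc]
    exact_mod_cast min_le_right _ _
  have hexp := hG T (by linarith) (by linarith)
  have hinter : (ν - ν ^ 3) * n ≤ ((robustOutNbhd G ν T ∩ S).card : ℝ) := by
    have h₁ : ((robustOutNbhd G ν T ∪ S).card : ℝ) + (robustOutNbhd G ν T ∩ S).card =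
        (robustOutNbhd G ν T).card + S.card := by
      exact_mod_cast Finset.card_union_add_card_inter _ _
    have h₂ : ((robustOutNbhd G ν T ∪ S).card : ℝ) ≤ n := by
      exact Nat.cast_le.mpr (Finset.card_le_univ _)
    linarith
  have hedges := mul_card_robustOutNbhd_inter_le G ν (ν ^ 3 * n) S T fun t ht => by
    have h := Finset.mem_compl.mp (hTB ht)
    simp only [robustInNbhd, Finset.mem_filter, Finset.mem_univ, true_and, not_le] at h
    exact h.le
  have h₁ : (ν - ν ^ 3) * n * (ν * n) ≤ n * (ν ^ 3 * n) := by
    refine (mul_le_mul_of_nonneg_right hinter hνn.le).trans (hedges.trans ?_)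
    gcongr
    linarith [(Nat.cast_nonneg S.card : (0 : ℝ) ≤ S.card)]
  have h₂ : (ν * n) ^ 2 * (1 - ν ^ 2 - ν) ≤ 0 := by linarith
  have h₃ : 0 < (ν * n) ^ 2 * (1 - ν ^ 2 - ν) := mul_pos (by positivity) (by linarith)
  linarith

/-- **Robust outexpansion implies robust inexpansion (DeBiasio).** A sufficiently large
digraph of minimum semidegree at least `ηn` which is a robust `(ν,τ)`-outexpander is
also a robust `(ν³, 2τ)`-inexpander. -/
theorem robust_outexpander_inexpander (η : ℝ) (hη0 : 0 < η) (hη1 : η < 1) :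
    ∃ τ₀ : ℝ, 0 < τ₀ ∧ ∀ τ : ℝ, 0 < τ → τ ≤ τ₀ → ∀ ν : ℝ, 0 < ν → ν ≤ τ →
    ∃ n₀ : ℕ, ∀ (V : Type) [Fintype V] (G : V → V → Prop),
      (∀ v : V, ¬ G v v) →
      n₀ ≤ Fintype.card V →
      (∀ v : V, η * (Fintype.card V : ℝ) ≤ (outDeg G v : ℝ) ∧
        η * (Fintype.card V : ℝ) ≤ (inDeg G v : ℝ)) →
      RobustOutexpander G ν τ →
      RobustInexpander G (ν ^ 3) (2 * τ) := by
  refine ⟨1 / 2, by norm_num, fun τ _ hτ ν hν hντ => ⟨0, fun V _ G _ _ _ hG => ?_⟩⟩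
  exact hG.robustInexpander hν hντ hτ
end

section
/- Suppose 0 < ε < d < 1 with 3ε ≤ d², and let G be a digraph on n vertices that is ε-regular with density d and satisfies δ⁰(G) ≥ (d − ε)n (i.e. G is [ε, d−ε]-superregular with density d). Then G contains a 1-factor: there is a permutation σ of the vertex set of G such that (x, σ(x)) is a directed edge of G for every vertex x. -/
open Finset
open scoped Classical

/-- The number of directed edges of `G` from `X` to `Y`. -/
noncomputable def diEdgeCnt {V : Type*} (G : V → V → Prop) (X Y : Finset V) : ℕ :=
  ((X ×ˢ Y).filter fun p => G p.1 p.2).card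

/-- The density `d_G(X,Y)` of the directed pair `(X,Y)`. -/
noncomputable def diDensity {V : Type*} (G : V → V → Prop) (X Y : Finset V) : ℝ :=
  (diEdgeCnt G X Y : ℝ) / ((X.card : ℝ) * (Y.card : ℝ))

/-- A digraph `G` on `n` vertices is `ε`-regular with density `d` if all pairs of sets
of at least `εn` vertices have density within `ε` of `d`. -/
def DiRegular {V : Type*} [Fintype V] (G : V → V → Prop) (ε d : ℝ) : Prop :=
  ∀ X Y : Finset V, ε * (Fintype.card V : ℝ) ≤ (X.card : ℝ) →
    ε * (Fintype.card V : ℝ) ≤ (Y.card : ℝ) →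
    |diDensity G X Y - d| < ε

/-- In a regular digraph of density at least `ε`, two sets with no edge from the first to the
second cannot both have at least `εn` vertices. -/
theorem DiRegular.card_lt_or_card_lt_of_no_edges {V : Type*} [Fintype V] {G : V → V → Prop}
    {ε d : ℝ} (hreg : DiRegular G ε d) (hεd : ε ≤ d) {X Y : Finset V}
    (hXY : ∀ x ∈ X, ∀ y ∈ Y, ¬ G x y) :
    (X.card : ℝ) < ε * (Fintype.card V : ℝ) ∨ (Y.card : ℝ) < ε * (Fintype.card V : ℝ) := by
  by_contra! h
  have hcnt : diEdgeCnt G X Y = 0 := by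
    unfold diEdgeCnt
    rw [Finset.card_eq_zero, Finset.filter_eq_empty_iff]
    intro p hp
    rw [Finset.mem_product] at hp
    exact hXY _ hp.1 _ hp.2
  have hlt := hreg X Y h.1 h.2
  rw [diDensity, hcnt, Nat.cast_zero, zero_div, zero_sub, abs_neg] at hlt
  linarith [le_abs_self d]

/-- Hall's condition for a regular digraph whose semidegree is at least `εn`. -/
theorem DiRegular.card_le_card_outNbhd {V : Type*} [Fintype V] {G : V → V → Prop}
    {ε d : ℝ} (hreg : DiRegular G ε d) (hεd : ε ≤ d)
    (hdeg : ∀ v : V, ε * (Fintype.card V : ℝ) ≤ (outDeg G v : ℝ) ∧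
      ε * (Fintype.card V : ℝ) ≤ (inDeg G v : ℝ)) (A : Finset V) :
    A.card ≤ (Finset.univ.filter fun y => ∃ x ∈ A, G x y).card := by
  by_contra! hlt
  set N := Finset.univ.filter fun y => ∃ x ∈ A, G x y
  have hedge : ∀ x ∈ A, ∀ y ∈ Nᶜ, ¬ G x y := by
    intro x hx y hy hxy
    exact (Finset.mem_compl.mp hy) (Finset.mem_filter.mpr ⟨Finset.mem_univ y, x, hx, hxy⟩)
  have hNc : N.card + Nᶜ.card = Fintype.card V := Finset.card_add_card_compl N
  have hAc : A.card + Aᶜ.card = Fintype.card V := Finset.card_add_card_compl A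
  rcases hreg.card_lt_or_card_lt_of_no_edges hεd hedge with hsmall | hsmall
  · obtain ⟨x, hx⟩ : A.Nonempty := Finset.card_pos.mp (by omega)
    have hsub : outDeg G x ≤ N.card := by
      refine Finset.card_le_card fun y hy => ?_
      exact Finset.mem_filter.mpr ⟨Finset.mem_univ y, x, hx, (Finset.mem_filter.mp hy).2⟩
    have h : (outDeg G x : ℝ) < A.card := by exact_mod_cast hsub.trans_lt hlt
    linarith [(hdeg x).1]
  · obtain ⟨y, hy⟩ : Nᶜ.Nonempty := Finset.card_pos.mp (by omega)
    have hsub : inDeg G y ≤ Aᶜ.card := by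
      refine Finset.card_le_card fun x hx => ?_
      exact Finset.mem_compl.mpr fun hxA => hedge x hxA y hy (Finset.mem_filter.mp hx).2
    have h : (inDeg G y : ℝ) < Nᶜ.card := by
      exact_mod_cast (show inDeg G y < Nᶜ.card by omega)
    linarith [(hdeg y).2]

/-- An `[ε, d−ε]`-superregular digraph of density `d` (with `3ε ≤ d²`) contains a
`1`-factor: a permutation `σ` of the vertices with `(x, σ x)` an edge for every `x`. -/
theorem superregular_one_factor {V : Type} [Fintype V]
    (G : V → V → Prop) (hirr : ∀ v : V, ¬ G v v) (ε d : ℝ)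
    (hε : 0 < ε) (hεd : ε < d) (hd : d < 1) (h3ε : 3 * ε ≤ d ^ 2)
    (hreg : DiRegular G ε d)
    (hdeg : ∀ v : V, (d - ε) * (Fintype.card V : ℝ) ≤ (outDeg G v : ℝ) ∧
      (d - ε) * (Fintype.card V : ℝ) ≤ (inDeg G v : ℝ)) :
    ∃ σ : Equiv.Perm V, ∀ x : V, G x (σ x) := by
  have hle : ε ≤ d - ε := by nlinarith
  have hmul : ε * (Fintype.card V : ℝ) ≤ (d - ε) * (Fintype.card V : ℝ) := by gcongr
  obtain ⟨f, hinj, hf⟩ := (Fintype.all_card_le_filter_rel_iff_exists_injective G).mp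
    (hreg.card_le_card_outNbhd hεd.le
      fun v => ⟨hmul.trans (hdeg v).1, hmul.trans (hdeg v).2⟩)
  exact ⟨Equiv.ofBijective f (Finite.injective_iff_bijective.mp hinj), hf⟩
end

section
/- There exists d₀ ∈ (0,1) such that for every d ∈ (0, d₀] there exists ε₀ > 0 such that for every ε ∈ (0, ε₀] there exists an integer n₀ so that the following holds: every digraph G on n ≥ n₀ vertices that is ε-regular with density d and satisfies δ⁰(G) ≥ (d − ε)n (i.e. G is [ε, d−ε]-superregular with density d) contains a directed Hamilton cycle. -/
open Finset
open scoped Classical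

/-- `c` runs periodically through a directed cycle of `G` of length `m`. -/
structure IsDiCycle {V : Type*} (G : V → V → Prop) (c : ℕ → V) (m : ℕ) : Prop where
  pos : 0 < m
  injOn : ∀ i < m, ∀ j < m, c i = c j → i = j
  periodic : ∀ i, c (i + m) = c i
  adj : ∀ i, G (c i) (c (i + 1))

/-- Any two sets of at least `k` vertices span an edge from the first to the second. -/
def LinksSets {V : Type*} (G : V → V → Prop) (k : ℕ) : Prop :=
  ∀ X Y : Finset V, k ≤ X.card → k ≤ Y.card → ∃ x ∈ X, ∃ y ∈ Y, G x y

section Cycles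

variable {V : Type*} {G : V → V → Prop} {c : ℕ → V} {m k : ℕ}

lemma IsDiCycle.of_path {g : ℕ → V} (hm : 0 < m)
    (hinj : ∀ i < m, ∀ j < m, g i = g j → i = j)
    (hadj : ∀ i, i + 1 < m → G (g i) (g (i + 1))) (hlast : G (g (m - 1)) (g 0)) :
    IsDiCycle G (fun i => g (i % m)) m where
  pos := hm
  injOn i hi j hj h := by
    simp only [Nat.mod_eq_of_lt hi, Nat.mod_eq_of_lt hj] at h
    exact hinj i hi j hj h
  periodic i := by simp
  adj i := by
    have hlt := Nat.mod_lt i hm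
    rw [← Nat.mod_add_mod i m 1]
    rcases Nat.lt_or_ge (i % m + 1) m with h | h
    · rw [Nat.mod_eq_of_lt h]
      exact hadj _ h
    · have h1 : i % m + 1 = m := by omega
      have h2 : i % m = m - 1 := by omega
      rw [h1, Nat.mod_self, h2]
      exact hlast

lemma IsDiCycle.apply_mod (h : IsDiCycle G c m) (i : ℕ) : c (i % m) = c i :=
  Function.Periodic.map_mod_nat h.periodic i

lemma IsDiCycle.shift (h : IsDiCycle G c m) (r : ℕ) : IsDiCycle G (fun i => c (i + r)) m where
  pos := h.pos
  injOn i hi j hj hij := by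
    simp only [← h.apply_mod (i + r), ← h.apply_mod (j + r)] at hij
    have h1 := h.injOn _ (Nat.mod_lt _ h.pos) _ (Nat.mod_lt _ h.pos) hij
    have h2 : i ≡ j [MOD m] := Nat.ModEq.add_right_cancel' r h1
    rwa [Nat.ModEq, Nat.mod_eq_of_lt hi, Nat.mod_eq_of_lt hj] at h2
  periodic i := by
    rw [show i + m + r = i + r + m by ring]
    exact h.periodic _
  adj i := by
    rw [show i + 1 + r = i + r + 1 by ring]
    exact h.adj _

lemma IsDiCycle.card_image (h : IsDiCycle G c m) {I : Finset ℕ} (hI : I ⊆ range m) :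
    (I.image c).card = I.card :=
  card_image_of_injOn fun i hi j hj hij =>
    h.injOn i (mem_range.1 (hI hi)) j (mem_range.1 (hI hj)) hij

lemma IsDiCycle.exists_adj (h : IsDiCycle G c m) (hG : LinksSets G k) {I J : Finset ℕ}
    (hI : I ⊆ range m) (hJ : J ⊆ range m) (hIk : k ≤ I.card) (hJk : k ≤ J.card) :
    ∃ i ∈ I, ∃ j ∈ J, G (c i) (c (j + 1)) := by
  have h1 := (h.shift 1).card_image hJ
  obtain ⟨x, hx, y, hy, hxy⟩ := hG (I.image c) (J.image fun j => c (j + 1))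
    (by rwa [h.card_image hI]) (by rwa [h1])
  obtain ⟨i, hi, rfl⟩ := mem_image.1 hx
  obtain ⟨j, hj, rfl⟩ := mem_image.1 hy
  exact ⟨i, hi, j, hj, hxy⟩

lemma IsDiCycle.exists_adj_adj (h : IsDiCycle G c m) (hG : LinksSets G k) {B P A : Finset ℕ}
    (hB : B ⊆ range m) (hP : P ⊆ range m) (hA : A ⊆ range m)
    (hBk : k ≤ B.card) (hPk : 2 * k ≤ P.card) (hAk : k ≤ A.card) :
    ∃ b ∈ B, ∃ p ∈ P, ∃ a ∈ A, G (c b) (c (p + 1)) ∧ G (c p) (c (a + 1)) := by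
  have hsum := card_filter_add_card_filter_not (s := P) fun p => ∃ a ∈ A, G (c p) (c (a + 1))
  have hlt : (P.filter fun p => ¬ ∃ a ∈ A, G (c p) (c (a + 1))).card < k := by
    by_contra! hge
    obtain ⟨p, hp, a, ha, hpa⟩ :=
      h.exists_adj hG ((filter_subset _ _).trans hP) hA hge hAk
    exact (mem_filter.1 hp).2 a ha hpa
  obtain ⟨b, hb, p, hp, hbp⟩ :=
    h.exists_adj hG hB ((filter_subset (fun p => ∃ a ∈ A, G (c p) (c (a + 1))) P).trans hP) hBk
      (by omega)
  obtain ⟨hp, a, ha, hpa⟩ := mem_filter.1 hp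
  exact ⟨b, hb, p, hp, a, ha, hbp, hpa⟩

/-- Exchanging three edges of a cycle makes room for a new vertex `v`. -/
lemma IsDiCycle.insert_vertex (h : IsDiCycle G c m) {v : V} (hv : ∀ i, c i ≠ v) {b p a : ℕ}
    (hbp : b < p) (hpa : p < a) (ham : a < b + m) (hvb : G v (c (b + 1)))
    (hbp' : G (c b) (c (p + 1))) (hpa' : G (c p) (c (a + 1))) (hav : G (c a) v) :
    ∃ c', IsDiCycle G c' (m + 1) := by
  obtain ⟨p, rfl⟩ : ∃ p', p = p' + b := ⟨p - b, by omega⟩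
  obtain ⟨a, rfl⟩ : ∃ a', a = a' + b := ⟨a - b, by omega⟩
  have hs := h.shift b
  set s : ℕ → V := fun i => c (i + b) with hsdef
  have hsv : ∀ i, s i ≠ v := fun i => hv _
  have hvb : G v (s 1) := by simpa [hsdef, add_comm] using hvb
  have hbp' : G (s m) (s (p + 1)) := by
    rw [show s m = c b by rw [← h.periodic b, add_comm b m],
      show s (p + 1) = c (p + b + 1) by simp only [hsdef]; congr 1; omega]
    exact hbp'
  have hpa' : G (s p) (s (a + 1)) := by
    rw [show s (a + 1) = c (a + b + 1) by simp only [hsdef]; congr 1; omega]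
    exact hpa'
  have hav : G (s a) v := hav
  clear_value s
  have hinj : ∀ i, 0 < i → i ≤ m → ∀ j, 0 < j → j ≤ m → s i = s j → i = j := by
    intro i hi him j hj hjm hij
    have := (hs.shift 1).injOn (i - 1) (by omega) (j - 1) (by omega)
      (by simpa [Nat.sub_add_cancel hi, Nat.sub_add_cancel hj] using hij)
    omega
  let f : ℕ → ℕ := fun i => if i ≤ p then i else if i ≤ p + (m - a) then a + (i - p)
    else i - (m - a)
  refine ⟨_, IsDiCycle.of_path (g := fun i => if i = 0 then v else s (f i)) (by omega) ?_ ?_ ?_⟩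
  · intro i hi j hj hij
    by_cases hi0 : i = 0 <;> by_cases hj0 : j = 0
    · omega
    · simp only [hi0, hj0, if_true, if_false] at hij
      exact absurd hij.symm (hsv _)
    · simp only [hi0, hj0, if_true, if_false] at hij
      exact absurd hij (hsv _)
    · simp only [hi0, hj0, if_false] at hij
      have := hinj (f i) (by simp only [f]; split_ifs <;> omega)
        (by simp only [f]; split_ifs <;> omega) (f j) (by simp only [f]; split_ifs <;> omega)
        (by simp only [f]; split_ifs <;> omega) hij
      simp only [f] at this
      split_ifs at this <;> omega
  · intro i hi
    rcases Nat.eq_zero_or_pos i with rfl | hi0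
    · simpa [f, show 1 ≤ p by omega] using hvb
    · simp only [hi0.ne', if_false, Nat.succ_ne_zero]
      by_cases h1 : i = p
      · have e1 : f i = p := by simp only [f]; split_ifs <;> omega
        have e2 : f (i + 1) = a + 1 := by simp only [f]; split_ifs <;> omega
        rw [e1, e2]
        exact hpa'
      by_cases h2 : i = p + (m - a)
      · have e1 : f i = m := by simp only [f]; split_ifs <;> omega
        have e2 : f (i + 1) = p + 1 := by simp only [f]; split_ifs <;> omega
        rw [e1, e2]
        exact hbp'
      · have e : f (i + 1) = f i + 1 := by simp only [f]; split_ifs <;> omega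
        rw [e]
        exact hs.adj _
  · have e : f m = a := by simp only [f]; split_ifs <;> omega
    simpa [show m ≠ 0 by omega, e] using hav

end Cycles

/-- An initial segment of a finite set of naturals can have any prescribed size. -/
lemma exists_card_filter_lt_eq (A : Finset ℕ) {q : ℕ} (hq : q ≤ A.card) :
    ∃ s, (A.filter (· < s)).card = q := by
  induction q with
  | zero => exact ⟨0, by simp⟩
  | succ q ih =>
    obtain ⟨s, hs⟩ := ih (by omega)
    have hsum := card_filter_add_card_filter_not (s := A) (· < s)
    have hne : (A.filter fun i => ¬ i < s).Nonempty := card_pos.1 (by omega)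
    set x := (A.filter fun i => ¬ i < s).min' hne with hx
    have hxm := mem_filter.1 (min'_mem _ hne)
    rw [← hx] at hxm
    refine ⟨x + 1, ?_⟩
    have : A.filter (· < x + 1) = insert x (A.filter (· < s)) := by
      ext y
      simp only [mem_filter, mem_insert]
      constructor
      · rintro ⟨hy, hyx⟩
        by_cases hys : y < s
        · exact Or.inr ⟨hy, hys⟩
        · have := min'_le _ y (mem_filter.2 ⟨hy, hys⟩ : y ∈ A.filter fun i => ¬ i < s)
          left; omega
      · rintro (rfl | ⟨hy, hys⟩)
        · exact ⟨hxm.1, by omega⟩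
        · exact ⟨hy, by omega⟩
    rw [this, card_insert_of_notMem (by simp [hxm.2]), hs]

section Finite

variable {V : Type*} [Fintype V] {G : V → V → Prop} {c : ℕ → V} {m k : ℕ}

lemma IsDiCycle.card_le (h : IsDiCycle G c m) : m ≤ Fintype.card V := by
  have := card_le_univ ((range m).image c)
  rwa [h.card_image Subset.rfl, card_range] at this

lemma IsDiCycle.card_filter_le (h : IsDiCycle G c m) (Q : V → Prop) :
    (univ.filter Q).card + m ≤ ((range m).filter fun i => Q (c i)).card + Fintype.card V := by
  have hsub : univ.filter Q ⊆
      ((range m).filter fun i => Q (c i)).image c ∪ ((range m).image c)ᶜ := by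
    intro x hx
    by_cases hxc : x ∈ (range m).image c
    · obtain ⟨i, hi, rfl⟩ := mem_image.1 hxc
      exact mem_union_left _ (mem_image_of_mem _ (mem_filter.2 ⟨hi, (mem_filter.1 hx).2⟩))
    · exact mem_union_right _ (mem_compl.2 hxc)
  have h1 := (card_le_card hsub).trans (card_union_le _ _)
  rw [card_compl, h.card_image Subset.rfl, card_range, h.card_image (filter_subset _ _)] at h1
  have := h.card_le
  omega

lemma IsDiCycle.exists_longer (h : IsDiCycle G c m) (hG : LinksSets G k) (hk : 0 < k)
    (hm : Fintype.card V ≤ m + 4 * k) (hmn : m < Fintype.card V)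
    (hout : ∀ v, 10 * k ≤ outDeg G v) (hin : ∀ v, 10 * k ≤ inDeg G v) :
    ∃ c', IsDiCycle G c' (m + 1) := by
  obtain ⟨v, hv⟩ : ∃ v, v ∉ (range m).image c := by
    by_contra! hall
    have := card_le_card (fun x _ => hall x : (univ : Finset V) ⊆ _)
    rw [h.card_image Subset.rfl, card_range, card_univ] at this
    omega
  have hv : ∀ i, c i ≠ v := fun i hi => hv (mem_image.2
    ⟨i % m, mem_range.2 (Nat.mod_lt _ h.pos), by rw [h.apply_mod, hi]⟩)
  set A := (range m).filter fun i => G (c i) v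
  set B := (range m).filter fun i => G v (c (i + 1))
  have hAc : 6 * k ≤ A.card := by
    have h1 : inDeg G v + m ≤ A.card + Fintype.card V := h.card_filter_le fun x => G x v
    have h2 := hin v
    omega
  have hBc : 6 * k ≤ B.card := by
    have h1 : outDeg G v + m ≤ B.card + Fintype.card V :=
      (h.shift 1).card_filter_le fun x => G v x
    have h2 := hout v
    omega
  have hAm : A ⊆ range m := filter_subset _ _
  have hBm : B ⊆ range m := filter_subset _ _
  obtain ⟨s, hs⟩ := exists_card_filter_lt_eq A (q := 2 * k) (by omega)
  have hs' := card_filter_add_card_filter_not (s := A) (· < s)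
  obtain ⟨t, ht⟩ := exists_card_filter_lt_eq (A.filter fun i => ¬ i < s) (q := 2 * k) (by omega)
  have ht' := card_filter_add_card_filter_not (s := A.filter fun i => ¬ i < s) (· < t)
  have hu := card_filter_add_card_filter_not (s := B) (· < s)
  have hu' := card_filter_add_card_filter_not (s := B.filter fun i => ¬ i < s) (· < t)
  set A₁ := A.filter (· < s)
  set A₂ := (A.filter fun i => ¬ i < s).filter (· < t)
  set A₃ := (A.filter fun i => ¬ i < s).filter fun i => ¬ i < t
  have hA₁ : A₁ ⊆ A := filter_subset _ _
  have hA₂ : A₂ ⊆ A := (filter_subset _ _).trans (filter_subset _ _)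
  have hA₃ : A₃ ⊆ A := (filter_subset _ _).trans (filter_subset _ _)
  have hst : s < t := by
    obtain ⟨x, hx⟩ : A₂.Nonempty := card_pos.1 (by omega)
    simp only [A₂, mem_filter] at hx
    omega
  have hcases : k ≤ (B.filter (· < s)).card ∨
      k ≤ ((B.filter fun i => ¬ i < s).filter (· < t)).card ∨
      k ≤ ((B.filter fun i => ¬ i < s).filter fun i => ¬ i < t).card := by omega
  have hperA : ∀ a, c (a + m + 1) = c (a + 1) := fun a => by
    rw [show a + m + 1 = a + 1 + m by ring]; exact h.periodic _
  rcases hcases with hBk | hBk | hBk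
  · obtain ⟨b, hb, p, hp, a, ha, hbp, hpa⟩ := h.exists_adj_adj hG ((filter_subset _ _).trans hBm)
      (hA₂.trans hAm) (hA₃.trans hAm) hBk (by omega) (by omega)
    simp only [A, B, A₂, A₃, mem_filter, mem_range] at hb hp ha
    exact h.insert_vertex hv (b := b) (p := p) (a := a) (by omega) (by omega) (by omega)
      hb.1.2 hbp hpa ha.1.1.2
  · obtain ⟨b, hb, p, hp, a, ha, hbp, hpa⟩ := h.exists_adj_adj hG
      (((filter_subset _ _).trans (filter_subset _ _)).trans hBm)
      (hA₃.trans hAm) (hA₁.trans hAm) hBk (by omega) (by omega)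
    simp only [A, B, A₁, A₃, mem_filter, mem_range] at hb hp ha
    exact h.insert_vertex hv (b := b) (p := p) (a := a + m) (by omega) (by omega) (by omega)
      hb.1.1.2 hbp (by rwa [hperA]) (by rw [h.periodic]; exact ha.1.2)
  · obtain ⟨b, hb, p, hp, a, ha, hbp, hpa⟩ := h.exists_adj_adj hG
      (((filter_subset _ _).trans (filter_subset _ _)).trans hBm)
      (hA₁.trans hAm) (hA₂.trans hAm) hBk (by omega) (by omega)
    simp only [A, B, A₁, A₂, mem_filter, mem_range] at hb hp ha
    exact h.insert_vertex hv (b := b) (p := p + m) (a := a + m) (by omega) (by omega) (by omega)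
      hb.1.1.2 (by rwa [hperA]) (by rwa [hperA, h.periodic]) (by rw [h.periodic]; exact ha.1.1.2)

lemma IsDiCycle.hasDiHamCycle (h : IsDiCycle G c (Fintype.card V)) : HasDiHamCycle G := by
  have : NeZero (Fintype.card V) := ⟨h.pos.ne'⟩
  have hinj : Function.Injective fun i : ZMod (Fintype.card V) => c i.val := fun i j hij =>
    ZMod.val_injective _ (h.injOn _ (ZMod.val_lt i) _ (ZMod.val_lt j) hij)
  refine ⟨Equiv.ofBijective _
    ((Fintype.bijective_iff_injective_and_card _).2 ⟨hinj, ZMod.card _⟩), fun i => ?_⟩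
  have hsucc : c (i + 1).val = c (i.val + 1) := by
    rw [ZMod.val_add, h.apply_mod]
    rcases eq_or_ne (Fintype.card V) 1 with h1 | h1
    · rw [← h.apply_mod, ← h.apply_mod (i.val + 1)]
      simp [h1, Nat.mod_one]
    · have : Fact (1 < Fintype.card V) := ⟨by have := h.pos; omega⟩
      rw [ZMod.val_one]
  simp only [Equiv.ofBijective_apply, hsucc]
  exact h.adj _

/-- Depth-first search: there is a path whose complement splits into two sets of equal size
with no edges from the first to the second. -/
lemma exists_path_balanced (G : V → V → Prop) (N : ℕ) : ∀ (S T : Finset V) (l : List V),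
    2 * T.card + l.length = N → S.card ≤ T.card → Disjoint S T → l.Nodup → l.IsChain G →
    (∀ x, x ∈ l ↔ x ∉ S ∧ x ∉ T) → (∀ x ∈ T, ∀ y ∈ S, ¬ G x y) →
    ∃ (S T : Finset V) (l : List V), S.card = T.card ∧ l.Nodup ∧ l.IsChain G ∧
      S.card + T.card + l.length = Fintype.card V ∧ (∀ x ∈ T, ∀ y ∈ S, ¬ G x y) := by
  induction N with
  | zero =>
    intro S T l hN hST hdisj hnd hch hl hno
    refine ⟨S, T, l, by omega, hnd, hch, ?_, hno⟩
    have hlT : l.toFinset = (S ∪ T)ᶜ := by ext x; simp [hl]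
    have h1 := List.toFinset_card_of_nodup hnd
    rw [hlT, card_compl, card_union_of_disjoint hdisj] at h1
    have h2 := card_le_univ (S ∪ T)
    rw [card_union_of_disjoint hdisj] at h2
    omega
  | succ N ih =>
    intro S T l hN hST hdisj hnd hch hl hno
    rcases hST.eq_or_lt with heq | hlt
    · refine ⟨S, T, l, heq, hnd, hch, ?_, hno⟩
      have hlT : l.toFinset = (S ∪ T)ᶜ := by ext x; simp [hl]
      have h1 := List.toFinset_card_of_nodup hnd
      rw [hlT, card_compl, card_union_of_disjoint hdisj] at h1
      have h2 := card_le_univ (S ∪ T)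
      rw [card_union_of_disjoint hdisj] at h2
      omega
    by_cases hpush : ∃ x ∈ T, (x :: l).IsChain G
    · obtain ⟨x, hx, hxl⟩ := hpush
      have hxS : x ∉ S := fun hxS => disjoint_left.1 hdisj hxS hx
      have hcard := card_erase_of_mem hx
      have hpos : 0 < T.card := card_pos.2 ⟨x, hx⟩
      refine ih S (T.erase x) (x :: l) (by simp only [List.length_cons]; omega) (by omega)
        (hdisj.mono_right (erase_subset _ _))
        (List.nodup_cons.2 ⟨fun h => ((hl x).1 h).2 hx, hnd⟩) hxl ?_
        (fun y hy => hno y (mem_of_mem_erase hy))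
      intro y
      rw [List.mem_cons, hl, mem_erase]
      by_cases hyx : y = x
      · subst hyx; simp [hxS]
      · simp [hyx]
    · push Not at hpush
      cases l with
      | nil =>
        obtain ⟨x, hx⟩ : T.Nonempty := card_pos.1 (by omega)
        exact absurd (List.isChain_singleton x) (hpush x hx)
      | cons z l =>
        obtain ⟨hzS, hzT⟩ := (hl z).1 List.mem_cons_self
        have hcard := card_insert_of_notMem hzS
        rw [List.nodup_cons] at hnd
        simp only [List.length_cons] at hN
        refine ih (insert z S) T l (by omega) (by omega)
          (disjoint_insert_left.2 ⟨hzT, hdisj⟩) hnd.2 hch.tail ?_ ?_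
        · intro y
          have := hl y
          rw [List.mem_cons] at this
          rw [mem_insert]
          by_cases hyz : y = z
          · subst hyz; simp [hnd.1]
          · simpa [hyz] using this
        · intro x hx y hy
          rcases mem_insert.1 hy with rfl | hy
          · exact fun hxy => hpush x hx (List.isChain_cons_cons.2 ⟨hxy, hch⟩)
          · exact hno x hx y hy

lemma LinksSets.exists_long_path (hG : LinksSets G k) :
    ∃ l : List V, l.Nodup ∧ l.IsChain G ∧ Fintype.card V ≤ l.length + 2 * k := by
  obtain ⟨S, T, l, hST, hnd, hch, hcard, hno⟩ := exists_path_balanced G _ ∅ univ [] rfl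
    (by simp) (by simp) (by simp) (by simp) (by simp) (by simp)
  refine ⟨l, hnd, hch, ?_⟩
  by_contra! hlt
  obtain ⟨x, hx, y, hy, hxy⟩ := hG T S (by omega) (by omega)
  exact hno x hx y hy hxy

lemma LinksSets.exists_long_cycle (hG : LinksSets G k) (hk : 0 < k)
    (hn : 4 * k ≤ Fintype.card V) :
    ∃ m c, IsDiCycle G c m ∧ Fintype.card V ≤ m + 4 * k := by
  obtain ⟨l, hnd, hch, hlen⟩ := hG.exists_long_path
  have hL : 2 * k ≤ l.length := by omega
  have : Nonempty V := Fintype.card_pos_iff.1 (by omega)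
  let g : ℕ → V := fun i => l.getD i (Classical.arbitrary V)
  have hg : ∀ i (hi : i < l.length), g i = l[i] := fun i hi => List.getD_eq_getElem _ _ hi
  have hginj : ∀ i < l.length, ∀ j < l.length, g i = g j → i = j := by
    intro i hi j hj hij
    rw [hg i hi, hg j hj] at hij
    exact (hnd.getElem_inj_iff).1 hij
  have hgadj : ∀ i, i + 1 < l.length → G (g i) (g (i + 1)) := by
    intro i hi
    rw [hg i (by omega), hg (i + 1) hi]
    exact List.isChain_iff_getElem.1 hch i hi
  obtain ⟨x, hx, y, hy, hxy⟩ := hG ((Ico (l.length - k) l.length).image g) ((range k).image g)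
    (by
      rw [card_image_of_injOn, Nat.card_Ico]
      · omega
      · intro i hi j hj
        exact hginj i (mem_Ico.1 hi).2 j (mem_Ico.1 hj).2)
    (by
      rw [card_image_of_injOn, card_range]
      intro i hi j hj
      have hi := mem_range.1 hi
      have hj := mem_range.1 hj
      exact hginj i (by omega) j (by omega))
  obtain ⟨j, hj, rfl⟩ := mem_image.1 hx
  obtain ⟨i, hi, rfl⟩ := mem_image.1 hy
  rw [mem_Ico] at hj
  rw [mem_range] at hi
  refine ⟨j + 1 - i, _, IsDiCycle.of_path (g := fun r => g (i + r)) (by omega) ?_ ?_ ?_, by omega⟩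
  · intro r hr r' hr' hrr
    have := hginj (i + r) (by omega) (i + r') (by omega) hrr
    omega
  · intro r hr
    exact hgadj (i + r) (by omega)
  · simpa [show i + (j + 1 - i - 1) = j by omega] using hxy

/-- A digraph with edges between any two sets of size `k` and with minimum semidegree at
least `10 * k` is Hamiltonian. -/
theorem LinksSets.hasDiHamCycle (hG : LinksSets G k) (hk : 0 < k) (hn : 4 * k ≤ Fintype.card V)
    (hout : ∀ v, 10 * k ≤ outDeg G v) (hin : ∀ v, 10 * k ≤ inDeg G v) : HasDiHamCycle G := by
  have key : ∀ r m c, IsDiCycle G c m → Fintype.card V ≤ m + 4 * k → m + r = Fintype.card V →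
      HasDiHamCycle G := by
    intro r
    induction r with
    | zero =>
      intro m c h _ hr
      obtain rfl : m = Fintype.card V := hr
      exact h.hasDiHamCycle
    | succ r ih =>
      intro m c h hm hr
      obtain ⟨c', hc'⟩ := h.exists_longer hG hk hm (by omega) hout hin
      exact ih (m + 1) c' hc' (by omega) (by omega)
  obtain ⟨m, c, h, hm⟩ := hG.exists_long_cycle hk hn
  exact key (Fintype.card V - m) m c h hm (by have := h.card_le; omega)

lemma DiRegular.linksSets {ε d : ℝ} (hG : DiRegular G ε d) (hεd : ε ≤ d)
    (hk : ε * (Fintype.card V : ℝ) ≤ k) : LinksSets G k := by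
  intro X Y hX hY
  by_contra! hno
  have h := hG X Y (hk.trans (by exact_mod_cast hX)) (hk.trans (by exact_mod_cast hY))
  have h0 : diEdgeCnt G X Y = 0 := by
    rw [diEdgeCnt, card_eq_zero, filter_eq_empty_iff]
    intro p hp
    exact hno _ (mem_product.1 hp).1 _ (mem_product.1 hp).2
  have h1 := neg_lt_of_abs_lt h
  rw [diDensity, h0] at h1
  simp only [Nat.cast_zero, zero_div] at h1
  linarith

end Finite

/-- Every sufficiently large `[ε, d−ε]`-superregular digraph of density `d` contains a
directed Hamilton cycle. -/
theorem superregular_hamilton_cycle :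
    ∃ d₀ : ℝ, 0 < d₀ ∧ d₀ < 1 ∧ ∀ d : ℝ, 0 < d → d ≤ d₀ →
    ∃ ε₀ : ℝ, 0 < ε₀ ∧ ∀ ε : ℝ, 0 < ε → ε ≤ ε₀ →
    ∃ n₀ : ℕ, ∀ (V : Type) [Fintype V] (G : V → V → Prop),
      (∀ v : V, ¬ G v v) →
      n₀ ≤ Fintype.card V →
      DiRegular G ε d →
      (∀ v : V, (d - ε) * (Fintype.card V : ℝ) ≤ (outDeg G v : ℝ) ∧
        (d - ε) * (Fintype.card V : ℝ) ≤ (inDeg G v : ℝ)) →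
      HasDiHamCycle G := by
  refine ⟨1 / 2, by norm_num, by norm_num, fun d hd _ => ⟨d / 50, by positivity, fun ε hε hεd => ?_⟩⟩
  refine ⟨⌈1 / ε⌉₊, fun V _ G _ hn hreg hdeg => ?_⟩
  have hεn : 1 ≤ ε * (Fintype.card V : ℝ) := by
    have := Nat.ceil_le.1 hn
    rwa [div_le_iff₀ hε, mul_comm] at this
  set k := ⌈ε * (Fintype.card V : ℝ)⌉₊ with hk
  have hkle : (k : ℝ) ≤ 2 * (ε * (Fintype.card V : ℝ)) := by
    have := Nat.ceil_lt_add_one (zero_le_one.trans hεn)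
    linarith
  have hdk : 10 * (k : ℝ) ≤ (d - ε) * (Fintype.card V : ℝ) := by
    have : 50 * ε * (Fintype.card V : ℝ) ≤ d * (Fintype.card V : ℝ) := by
      gcongr
      linarith
    linarith
  have hout : ∀ v, 10 * k ≤ outDeg G v := fun v => by
    exact_mod_cast hdk.trans (hdeg v).1
  have hin : ∀ v, 10 * k ≤ inDeg G v := fun v => by
    exact_mod_cast hdk.trans (hdeg v).2
  have hkpos : 0 < k := Nat.ceil_pos.2 (by linarith)
  have hcard : 0 < Fintype.card V := by
    rcases Nat.eq_zero_or_pos (Fintype.card V) with h0 | h0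
    · rw [h0] at hεn
      norm_num at hεn
    · exact h0
  obtain ⟨v⟩ := Fintype.card_pos_iff.1 hcard
  have hkn : 4 * k ≤ Fintype.card V := by
    have h1 := hout v
    have h2 : outDeg G v ≤ Fintype.card V := card_le_univ _
    omega
  exact (hreg.linksSets (by linarith) (Nat.le_ceil _)).hasDiHamCycle hkpos hkn hout hin
end
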